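/- Suppose Φ is irreducible and not of type G₂, and let Ψ ⊆ Φ⁺ be a combinatorial ideal. Then 𝔞_Ψ = ⊕_{α∈Ψ} 𝔤_α is a spherical subspace of 𝔫 (i.e. ad(x)⁴ = 0 for all x ∈ 𝔞_Ψ) if and only if ⟨α,β⟩ ≥ 0 for all α, β ∈ Ψ. -/

import Mathlib

/- Background setup: a finite reduced crystallographic root system `Φ` with chosen
positive roots `Φ⁺` in a euclidean space `V`, the Cartan pairing, and the basic
combinatorial notions used in the statement. -/

open scoped RealInnerProductSpace

noncomputable section

variable {V : Type*} [NormedAddCommGroup V] [InnerProductSpace ℝ V]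

/-- The Cartan pairing `⟨α, β⟩ = 2 (α, β) / (β, β)`. -/
def cpair (α β : V) : ℝ := 2 * ⟪α, β⟫ / ⟪β, β⟫

/-- The reflection associated to `β`, as a linear endomorphism of `V`:
`v ↦ v - (2 (β, v)/(β, β)) • β`. -/
def reflEnd (β : V) : Module.End ℝ V :=
  LinearMap.id -
    (LinearMap.toSpanSingleton ℝ V β ∘ₗ ((2 / ⟪β, β⟫) • (innerSL ℝ β).toLinearMap))

/-- A subset of `V` is orthogonal if the Cartan pairing of any two distinct
elements vanishes. -/
def OrthogonalSet (S : Set V) : Prop := ∀ γ ∈ S, ∀ γ' ∈ S, γ ≠ γ' → cpair γ γ' = 0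

/-- A finite reduced crystallographic root system in the euclidean space `V`,
together with a choice of positive roots. -/
structure RootSystemData (V : Type*) [NormedAddCommGroup V] [InnerProductSpace ℝ V] where
  /-- the set of roots Φ -/
  roots : Set V
  /-- the set of positive roots Φ⁺ -/
  pos : Set V
  finite : roots.Finite
  ne_zero : ∀ α ∈ roots, α ≠ 0
  span_eq_top : Submodule.span ℝ roots = ⊤
  reduced : ∀ α ∈ roots, ∀ t : ℝ, t • α ∈ roots → t = 1 ∨ t = -1
  crystallographic : ∀ α ∈ roots, ∀ β ∈ roots, ∃ n : ℤ, cpair α β = (n : ℝ)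
  reflect_mem : ∀ α ∈ roots, ∀ β ∈ roots, reflEnd β α ∈ roots
  pos_subset : pos ⊆ roots
  pos_iff : ∀ α ∈ roots, (α ∈ pos ↔ ¬ (-α ∈ pos))
  pos_add : ∀ α ∈ pos, ∀ β ∈ pos, α + β ∈ roots → α + β ∈ pos

namespace RootSystemData

variable (D : RootSystemData V)

/-- Irreducibility: the roots admit no nontrivial partition into two mutually
orthogonal parts. -/
def IsIrreducible : Prop :=
  D.roots.Nonempty ∧
    ∀ s ⊆ D.roots, (∀ α ∈ s, ∀ β ∈ D.roots \ s, ⟪α, β⟫ = 0) → s = ∅ ∨ s = D.roots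

/-- An irreducible root system is not of type `G₂` iff no Cartan pairing of two
roots equals `±3`. -/
def NotG2 : Prop := ∀ α ∈ D.roots, ∀ β ∈ D.roots, cpair α β ≠ 3 ∧ cpair α β ≠ -3

/-- An irreducible root system is of type `G₂` iff some Cartan pairing of two
roots equals `±3`. -/
def IsG2 : Prop :=
  D.IsIrreducible ∧ ∃ α ∈ D.roots, ∃ β ∈ D.roots, cpair α β = 3 ∨ cpair α β = -3

/-- All roots have the same length (types A, D, E). -/
def SimplyLaced : Prop := ∀ α ∈ D.roots, ∀ β ∈ D.roots, ⟪α, α⟫ = ⟪β, β⟫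

/-- There are exactly two root lengths, with squared-length ratio 2
(types B, C, F₄). -/
def DoublyLaced : Prop :=
  (∃ α ∈ D.roots, ∃ β ∈ D.roots, ⟪β, β⟫ = 2 * ⟪α, α⟫) ∧
    ∀ α ∈ D.roots, ∀ β ∈ D.roots,
      ⟪α, α⟫ = ⟪β, β⟫ ∨ ⟪β, β⟫ = 2 * ⟪α, α⟫ ∨ ⟪α, α⟫ = 2 * ⟪β, β⟫

/-- A root of maximal length. -/
def IsLong (α : V) : Prop := α ∈ D.roots ∧ ∀ β ∈ D.roots, ⟪β, β⟫ ≤ ⟪α, α⟫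

/-- A root of minimal length. -/
def IsShort (α : V) : Prop := α ∈ D.roots ∧ ∀ β ∈ D.roots, ⟪α, α⟫ ≤ ⟪β, β⟫

/-- A set of positive roots is convex if any root which is a linear combination of
two of its elements with positive coefficients lies in it. -/
def ConvexSubset (S : Set V) : Prop :=
  ∀ α ∈ S, ∀ β ∈ S, ∀ a b : ℝ, 0 < a → 0 < b →
    a • α + b • β ∈ D.roots → a • α + b • β ∈ S

/-- A subset `Ψ ⊆ Φ⁺` is biconvex if both `Ψ` and `Φ⁺ \ Ψ` are convex. -/
def Biconvex (S : Set V) : Prop :=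
  S ⊆ D.pos ∧ D.ConvexSubset S ∧ D.ConvexSubset (D.pos \ S)

/-- A subset `Ψ ⊆ Φ⁺` is a combinatorial ideal if `α ∈ Ψ`, `β ∈ Φ⁺`, `α + β ∈ Φ⁺`
imply `α + β ∈ Ψ`. -/
def CombIdeal (S : Set V) : Prop :=
  S ⊆ D.pos ∧ ∀ α ∈ S, ∀ β ∈ D.pos, α + β ∈ D.pos → α + β ∈ S

end RootSystemData

/- The Lie-theoretic setup: a finite-dimensional complex simple Lie algebra `𝔤`
with Cartan subalgebra `𝔱`, whose root space decomposition is indexed by the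
root system `Φ ⊆ V`. -/

/-- A finite-dimensional simple complex Lie algebra `L`, together with a Cartan
subalgebra and its root space decomposition, whose root system is `Φ ⊆ V` with a
choice of positive roots (determining the Borel subalgebra `𝔟 = 𝔱 ⊕ 𝔫`). -/
structure LieRootData (V : Type*) [NormedAddCommGroup V] [InnerProductSpace ℝ V]
    (L : Type*) [LieRing L] [LieAlgebra ℂ L] extends RootSystemData V where
  /-- the Cartan subalgebra 𝔱 -/
  cartan : LieSubalgebra ℂ L
  /-- the root space 𝔤_α attached to each root α -/
  rs : V → Submodule ℂ L
  finiteDim : FiniteDimensional ℂ L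
  isSimple : LieAlgebra.IsSimple ℂ L
  isCartan : cartan.IsCartanSubalgebra
  rs_dim : ∀ α ∈ roots, Module.finrank ℂ (rs α) = 1
  sup_eq_top : cartan.toSubmodule ⊔ (⨆ α ∈ roots, rs α) = ⊤
  indep : ∀ α ∈ roots, rs α ⊓ (cartan.toSubmodule ⊔ ⨆ β ∈ roots \ {α}, rs β) = ⊥
  weight_vec : ∀ α ∈ roots, ∀ h ∈ cartan, ∀ x ∈ rs α, ∃ c : ℂ, ⁅h, x⁆ = c • x
  bracket_mem : ∀ α ∈ roots, ∀ β ∈ roots, α + β ∈ roots →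
    ∀ x ∈ rs α, ∀ y ∈ rs β, ⁅x, y⁆ ∈ rs (α + β)
  bracket_ne_zero : ∀ α ∈ roots, ∀ β ∈ roots, α + β ∈ roots →
    ∀ x ∈ rs α, x ≠ 0 → ∀ y ∈ rs β, y ≠ 0 → ⁅x, y⁆ ≠ 0
  bracket_eq_zero : ∀ α ∈ roots, ∀ β ∈ roots, α + β ∉ roots → α + β ≠ 0 →
    ∀ x ∈ rs α, ∀ y ∈ rs β, ⁅x, y⁆ = 0
  bracket_cartan_mem : ∀ α ∈ roots, ∀ x ∈ rs α, ∀ y ∈ rs (-α), ⁅x, y⁆ ∈ cartan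

namespace LieRootData

variable {L : Type*} [LieRing L] [LieAlgebra ℂ L] (D : LieRootData V L)

/-- The nilradical `𝔫 = ⊕_{α ∈ Φ⁺} 𝔤_α` of the Borel subalgebra, as a submodule. -/
def nilrad : Submodule ℂ L := ⨆ α ∈ D.pos, D.rs α

/-- The Borel subalgebra `𝔟 = 𝔱 ⊕ 𝔫`, as a submodule. -/
def borel : Submodule ℂ L := D.cartan.toSubmodule ⊔ D.nilrad

/-- The subspace `𝔞_Ψ = ⊕_{α ∈ Ψ} 𝔤_α` attached to a subset `Ψ ⊆ Φ⁺`. -/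
def aSubspace (S : Set V) : Submodule ℂ L := ⨆ α ∈ S, D.rs α

end LieRootData

/-- A subspace of `𝔫` is spherical if `ad(x)^4 = 0` for every `x` in it. -/
def IsSphericalSubspace {L : Type*} [LieRing L] [LieAlgebra ℂ L]
    (a : Submodule ℂ L) : Prop :=
  ∀ x ∈ a, (LieAlgebra.ad ℂ L x) ^ 4 = 0

/-- The height of a nilpotent element `x`: `max {n | ad(x)^n ≠ 0}`. -/
noncomputable def heightOf {L : Type*} [LieRing L] [LieAlgebra ℂ L] (x : L) : ℕ :=
  sSup {n : ℕ | (LieAlgebra.ad ℂ L x) ^ n ≠ 0}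


namespace SphAux

/-! ### Root system preliminaries -/

section RootSys

variable (D : RootSystemData V)

lemma refl_apply (β α : V) : reflEnd β α = α - cpair α β • β := by
  simp only [reflEnd, cpair, LinearMap.sub_apply, LinearMap.id_apply, LinearMap.comp_apply,
    LinearMap.smul_apply, LinearMap.toSpanSingleton_apply]
  congr 2
  simp [real_inner_comm]
  ring

lemma refl_mem' {α β : V} (hα : α ∈ D.roots) (hβ : β ∈ D.roots) :
    α - cpair α β • β ∈ D.roots := by
  rw [← refl_apply]; exact D.reflect_mem α hα β hβ

lemma self_pos {α : V} (hα : α ∈ D.roots) : 0 < ⟪α, α⟫ :=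
  real_inner_self_pos.2 (D.ne_zero α hα)

lemma cpair_self {α : V} (hα : α ∈ D.roots) : cpair α α = 2 := by
  have := self_pos D hα
  unfold cpair; field_simp

lemma neg_mem {α : V} (hα : α ∈ D.roots) : -α ∈ D.roots := by
  have := refl_mem' D hα hα
  rw [cpair_self D hα, two_smul] at this
  simpa using this

lemma cpair_mul {α β : V} (hβ : β ∈ D.roots) : cpair α β * ⟪β, β⟫ = 2 * ⟪α, β⟫ := by
  have := self_pos D hβ
  unfold cpair; field_simp

/-- If two roots have positive inner product then their difference is a root or zero. -/
lemma sub_mem {α β : V} (hα : α ∈ D.roots) (hβ : β ∈ D.roots) (h : 0 < ⟪α, β⟫) (hne : α ≠ β) :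
    α - β ∈ D.roots := by
  obtain ⟨m, hm⟩ := D.crystallographic α hα β hβ
  obtain ⟨n, hn⟩ := D.crystallographic β hβ α hα
  have h1 := cpair_mul D (α := α) hβ
  have h2 := cpair_mul D (α := β) hα
  have pa := self_pos D hα
  have pb := self_pos D hβ
  rw [hm] at h1
  rw [hn, real_inner_comm α β] at h2
  have hm0 : 0 < m := by
    by_contra hc
    have : (m : ℝ) ≤ 0 := by exact_mod_cast not_lt.1 hc
    nlinarith
  have hn0 : 0 < n := by
    by_contra hc
    have : (n : ℝ) ≤ 0 := by exact_mod_cast not_lt.1 hc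
    nlinarith
  by_cases hm1 : m = 1
  · have := refl_mem' D hα hβ
    rw [hm, hm1] at this
    simpa using this
  by_cases hn1 : n = 1
  · have := neg_mem D (refl_mem' D hβ hα)
    rw [hn, hn1] at this
    simpa using this
  exfalso
  have hm2 : (2 : ℝ) ≤ m := by exact_mod_cast (by omega : 2 ≤ m)
  have hn2 : (2 : ℝ) ≤ n := by exact_mod_cast (by omega : 2 ≤ n)
  have h3 : ⟪β, β⟫ ≤ ⟪α, β⟫ := by nlinarith
  have h4 : ⟪α, α⟫ ≤ ⟪α, β⟫ := by nlinarith
  have h5 : ⟪α - β, α - β⟫ ≤ 0 := by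
    simp only [inner_sub_left, inner_sub_right, real_inner_comm α β]
    have := real_inner_comm α β
    linarith
  exact hne (sub_eq_zero.1 (real_inner_self_nonpos.1 h5))

lemma add_mem {α β : V} (hα : α ∈ D.roots) (hβ : β ∈ D.roots) (h : ⟪α, β⟫ < 0) (hne : α + β ≠ 0) :
    α + β ∈ D.roots := by
  have := sub_mem D hα (neg_mem D hβ) (by simpa using h)
    (fun h => hne (by rw [h]; simp))
  simpa using this

lemma pos_or {α : V} (hα : α ∈ D.roots) : α ∈ D.pos ∨ -α ∈ D.pos := by
  have := D.pos_iff α hα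
  tauto

lemma neg_not_pos {α : V} (hα : α ∈ D.pos) : -α ∉ D.pos :=
  (D.pos_iff α (D.pos_subset hα)).1 hα

lemma pos_add_ne {α β : V} (hα : α ∈ D.pos) (hβ : β ∈ D.pos) : α + β ≠ 0 := by
  intro h
  have : β = -α := by rw [eq_neg_iff_add_eq_zero, add_comm]; exact h
  exact neg_not_pos D hα (this ▸ hβ)

lemma sum_ne_aux (n : ℕ) : ∀ s : Multiset V, s.card = n + 1 → (∀ x ∈ s, x ∈ D.pos) → s.sum ≠ 0 := by
  induction n with
  | zero =>
    intro s hs hp h0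
    obtain ⟨a, rfl⟩ := Multiset.card_eq_one.1 hs
    exact D.ne_zero a (D.pos_subset (hp a (by simp))) (by simpa using h0)
  | succ k ih =>
    intro s hs hp h0
    obtain ⟨a, ha⟩ := Multiset.card_pos_iff_exists_mem.1 (by omega : 0 < s.card)
    obtain ⟨t, rfl⟩ := Multiset.exists_cons_of_mem ha
    have hap : a ∈ D.pos := hp a (by simp)
    rw [Multiset.sum_cons] at h0
    have hneg : ∃ b ∈ t, ⟪a, b⟫ < 0 := by
      by_contra hc
      push Not at hc
      have h1 : 0 ≤ ⟪a, t.sum⟫ := by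
        clear h0 hs hp ha
        induction t using Multiset.induction_on with
        | empty => simp
        | cons c u ihu =>
          rw [Multiset.sum_cons, inner_add_right]
          have := hc c (by simp)
          have := ihu (fun b hb => hc b (by simp [hb]))
          linarith
      have h2 : ⟪a, a + t.sum⟫ = 0 := by rw [h0]; simp
      rw [inner_add_right] at h2
      have := self_pos D (D.pos_subset hap)
      linarith
    obtain ⟨b, hb, hab⟩ := hneg
    obtain ⟨u, rfl⟩ := Multiset.exists_cons_of_mem hb
    have hbp : b ∈ D.pos := hp b (by simp)
    have hr : a + b ∈ D.pos := D.pos_add a hap b hbp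
      (add_mem D (D.pos_subset hap) (D.pos_subset hbp) hab (pos_add_ne D hap hbp))
    refine ih ((a + b) ::ₘ u) (by simpa using hs) ?_ ?_
    · intro x hx
      rcases Multiset.mem_cons.1 hx with rfl | hx
      · exact hr
      · exact hp x (by simp [hx])
    · rw [Multiset.sum_cons] at h0 ⊢
      rw [← h0]; abel

/-- Minimal elements exist in every nonempty set of roots. -/
lemma exists_min (B : Set V) (hB : B ⊆ D.roots) (hne : B.Nonempty) :
    ∃ γ ∈ B, (∀ ε ∈ D.pos, γ - ε ∉ B) ∧ (∀ ε ∈ D.pos, ∀ ε' ∈ D.pos, γ - ε - ε' ∉ B) := by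
  let r : B → B → Prop := fun x y =>
    ∃ s : Multiset V, s ≠ 0 ∧ (∀ z ∈ s, z ∈ D.pos) ∧ (y : V) - x = s.sum
  have hfin : Finite B := (D.finite.subset hB).to_subtype
  have htr : IsTrans B r := ⟨by
    rintro x y z ⟨s, hs, hsp, hse⟩ ⟨t, ht, htp, hte⟩
    refine ⟨s + t, ?_, ?_, ?_⟩
    · simp [hs]
    · intro w hw
      rcases Multiset.mem_add.1 hw with h | h
      · exact hsp w h
      · exact htp w h
    · rw [Multiset.sum_add, ← hse, ← hte]; abel⟩
  have hir : Std.Irrefl r := ⟨by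
    rintro x ⟨s, hs, hsp, hse⟩
    have hc : s.card ≠ 0 := by simpa using hs
    exact sum_ne_aux D (s.card - 1) s (by omega) hsp (by rw [← hse]; simp)⟩
  have hwf : WellFounded r := Finite.wellFounded_of_trans_of_irrefl r
  obtain ⟨b0, hb0⟩ := hne
  obtain ⟨m, -, hm⟩ := hwf.has_min Set.univ ⟨⟨b0, hb0⟩, trivial⟩
  refine ⟨m, m.2, ?_, ?_⟩
  · intro ε hε hmem
    exact hm ⟨_, hmem⟩ trivial ⟨{ε}, by simp, by simpa using hε, by simp⟩
  · intro ε hε ε' hε' hmem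
    refine hm ⟨_, hmem⟩ trivial ⟨{ε, ε'}, by simp, ?_, ?_⟩
    · simp [hε, hε']
    · simp only [Multiset.insert_eq_cons, Multiset.sum_cons, Multiset.sum_singleton]; abel

/-- A positive root to which no positive root can be added. -/
structure IsTop (θ : V) : Prop where
  pos : θ ∈ D.pos
  top : ∀ ε ∈ D.pos, θ + ε ∉ D.roots

lemma exists_top (hirr : D.IsIrreducible) : ∃ θ, IsTop D θ := by
  obtain ⟨γ, hγ, h1, h2⟩ := exists_min D D.roots subset_rfl hirr.1
  have hng : γ ∉ D.pos := by
    intro hp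
    apply h2 γ hp γ hp
    simpa using neg_mem D hγ
  refine ⟨-γ, (pos_or D hγ).resolve_left hng, ?_⟩
  intro ε hε hmem
  apply h1 ε hε
  have := neg_mem D hmem
  rwa [neg_add, neg_neg, ← sub_eq_add_neg] at this

variable {D}

lemma IsTop.root {θ : V} (h : IsTop D θ) : θ ∈ D.roots := D.pos_subset h.pos

lemma IsTop.nonneg {θ : V} (h : IsTop D θ) {ε : V} (hε : ε ∈ D.pos) : 0 ≤ ⟪θ, ε⟫ := by
  by_contra hc
  exact h.top ε hε (add_mem D h.root (D.pos_subset hε) (not_le.1 hc) (pos_add_ne D h.pos hε))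

end RootSys

end SphAux

namespace SphAux

section Lengths

variable {D : RootSystemData V}

lemma pos_pair (hG : D.NotG2) {α β : V} (hα : α ∈ D.roots) (hβ : β ∈ D.roots)
    (h : 0 < ⟪α, β⟫) (hne : α ≠ β) :
    (⟪α, α⟫ = ⟪β, β⟫ ∧ 2 * ⟪α, β⟫ = ⟪β, β⟫) ∨ (⟪α, α⟫ = 2 * ⟪β, β⟫ ∧ ⟪α, β⟫ = ⟪β, β⟫) ∨
      (⟪β, β⟫ = 2 * ⟪α, α⟫ ∧ ⟪α, β⟫ = ⟪α, α⟫) := by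
  obtain ⟨m, hm⟩ := D.crystallographic α hα β hβ
  obtain ⟨n, hn⟩ := D.crystallographic β hβ α hα
  have gm := (hG α hα β hβ).1
  have gn := (hG β hβ α hα).1
  have h1 := cpair_mul D (α := α) hβ
  have h2 := cpair_mul D (α := β) hα
  have pa := self_pos D hα
  have pb := self_pos D hβ
  rw [hm] at h1 gm
  rw [hn, real_inner_comm α β] at h2
  rw [hn] at gn
  have hm0 : 0 < m := by
    by_contra hc
    have : (m : ℝ) ≤ 0 := by exact_mod_cast not_lt.1 hc
    nlinarith
  have hn0 : 0 < n := by
    by_contra hc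
    have : (n : ℝ) ≤ 0 := by exact_mod_cast not_lt.1 hc
    nlinarith
  have hm3 : m ≠ 3 := by rintro rfl; exact gm (by norm_num)
  have hn3 : n ≠ 3 := by rintro rfl; exact gn (by norm_num)
  have hmn : (m : ℝ) * n < 4 := by
    by_contra hc
    have hc := not_lt.1 hc
    set w : V := ⟪β, β⟫ • α - ⟪α, β⟫ • β with hw
    have hww : ⟪w, w⟫ = ⟪β, β⟫ * (⟪α, α⟫ * ⟪β, β⟫ - ⟪α, β⟫ * ⟪α, β⟫) := by
      rw [hw]
      simp only [inner_sub_left, inner_sub_right, real_inner_smul_left, real_inner_smul_right,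
        real_inner_comm α β]
      ring
    have h3 : ⟪α, α⟫ * ⟪β, β⟫ - ⟪α, β⟫ * ⟪α, β⟫ ≤ 0 := by
      have e : (m * n : ℝ) * (⟪α, α⟫ * ⟪β, β⟫) = 4 * (⟪α, β⟫ * ⟪α, β⟫) := by
        linear_combination (n * ⟪α, α⟫ : ℝ) * h1 + 2 * ⟪α, β⟫ * h2
      have := mul_pos pa pb
      nlinarith
    have hw0 : w = 0 := real_inner_self_nonpos.1 (by rw [hww]; nlinarith)
    have hab : (⟪α, β⟫ / ⟪β, β⟫) • β = α := by
      rw [hw, sub_eq_zero] at hw0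
      rw [div_eq_inv_mul, mul_smul, ← hw0, smul_smul, inv_mul_cancel₀ pb.ne', one_smul]
    rcases D.reduced β hβ _ (by rw [hab]; exact hα) with h4 | h4
    · rw [h4, one_smul] at hab; exact hne hab.symm
    · have : 0 < ⟪α, β⟫ / ⟪β, β⟫ := div_pos h pb
      linarith
  have hmn' : m * n < 4 := by exact_mod_cast hmn
  have hm4 : m < 4 := by nlinarith
  have hn4 : n < 4 := by nlinarith
  have hm' : m = 1 ∨ m = 2 := by omega
  have hn' : n = 1 ∨ n = 2 := by omega
  rcases hm' with rfl | rfl <;> rcases hn' with rfl | rfl <;> push_cast at h1 h2 <;>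
    norm_num at hmn'
  · left; constructor <;> linarith
  · right; right; constructor <;> linarith
  · right; left; constructor <;> linarith

lemma top_len_aux (hG : D.NotG2) {θ : V} (hθ : IsTop D θ) {α : V} (hα : α ∈ D.roots)
    (h : 0 < ⟪α, θ⟫) : ⟪α, α⟫ = ⟪θ, θ⟫ ∨ 2 * ⟪α, α⟫ = ⟪θ, θ⟫ := by
  by_cases hne : α = θ
  · left; rw [hne]
  rcases pos_pair hG hα hθ.root h hne with ⟨h1, -⟩ | ⟨h1, h2⟩ | ⟨h1, -⟩
  · left; exact h1
  · exfalso
    have hη := sub_mem D hα hθ.root h hne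
    rcases pos_or D hη with hp | hp
    · exact hθ.top _ hp (by simpa using hα)
    · refine hθ.top _ hp ?_
      have := neg_mem D (refl_mem' D hα hθ.root)
      have hc : cpair α θ = 2 := by
        have := self_pos D hθ.root
        unfold cpair; rw [h2]; field_simp
      rw [hc] at this
      convert this using 1
      rw [two_smul]; abel
  · right; exact h1.symm

lemma top_len_aux' (hG : D.NotG2) {θ : V} (hθ : IsTop D θ) {α : V} (hα : α ∈ D.roots)
    (h : ⟪α, θ⟫ ≠ 0) : ⟪α, α⟫ = ⟪θ, θ⟫ ∨ 2 * ⟪α, α⟫ = ⟪θ, θ⟫ := by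
  rcases lt_or_gt_of_ne h with h | h
  · have := top_len_aux hG hθ (neg_mem D hα) (by simpa using h)
    simpa using this
  · exact top_len_aux hG hθ hα h

/-- The orbit of `θ` under root reflections. -/
inductive Orb (D : RootSystemData V) (θ : V) : V → Prop
  | base : Orb D θ θ
  | step (o β : V) : Orb D θ o → β ∈ D.roots → Orb D θ (o - cpair o β • β)

lemma inner_refl_left {β : V} (hβ : β ∈ D.roots) (o α : V) :
    ⟪α, o - cpair o β • β⟫ = ⟪α - cpair α β • β, o⟫ := by
  have := self_pos D hβ
  simp only [inner_sub_left, inner_sub_right, real_inner_smul_left, real_inner_smul_right, cpair,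
    real_inner_comm o β]
  ring

lemma inner_refl_refl {β : V} (hβ : β ∈ D.roots) (α : V) :
    ⟪α - cpair α β • β, α - cpair α β • β⟫ = ⟪α, α⟫ := by
  have := self_pos D hβ
  have h2 := cpair_mul D (α := α) hβ
  simp only [inner_sub_left, inner_sub_right, real_inner_smul_left, real_inner_smul_right,
    real_inner_comm α β]
  linear_combination cpair α β * h2

lemma lengths (hirr : D.IsIrreducible) (hG : D.NotG2) {θ : V} (hθ : IsTop D θ) {α : V}
    (hα : α ∈ D.roots) : ⟪α, α⟫ = ⟪θ, θ⟫ ∨ 2 * ⟪α, α⟫ = ⟪θ, θ⟫ := by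
  have key : ∀ o, Orb D θ o → ∀ α ∈ D.roots, ⟪α, o⟫ ≠ 0 →
      (⟪α, α⟫ = ⟪θ, θ⟫ ∨ 2 * ⟪α, α⟫ = ⟪θ, θ⟫) := by
    intro o ho
    induction ho with
    | base => intro α hα h; exact top_len_aux' hG hθ hα h
    | step o β ho hβ ih =>
      intro α hα h
      rw [inner_refl_left hβ] at h
      have := ih _ (refl_mem' D hα hβ) h
      rwa [inner_refl_refl hβ] at this
  rcases hirr.2 {a | a ∈ D.roots ∧ ∀ o, Orb D θ o → ⟪a, o⟫ = 0} (fun a ha => ha.1) (by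
    rintro a ⟨ha, ha0⟩ b ⟨hb, hb'⟩
    have : ∃ o, Orb D θ o ∧ ⟪b, o⟫ ≠ 0 := by
      by_contra hc
      push Not at hc
      exact hb' ⟨hb, hc⟩
    obtain ⟨o, ho, hbo⟩ := this
    have h1 := ha0 o ho
    have h2 := ha0 _ (Orb.step o b ho hb)
    rw [inner_sub_right, h1, real_inner_smul_right, zero_sub, neg_eq_zero] at h2
    refine (mul_eq_zero.1 h2).resolve_left ?_
    have := self_pos D hb
    unfold cpair
    rw [real_inner_comm]
    positivity) with h | h
  · by_contra hc
    have : α ∈ ({a | a ∈ D.roots ∧ ∀ o, Orb D θ o → ⟪a, o⟫ = 0} : Set V) := by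
      refine ⟨hα, fun o ho => ?_⟩
      by_contra h0
      exact hc (key o ho α hα h0)
    rw [h] at this
    exact this
  · have : θ ∈ ({a | a ∈ D.roots ∧ ∀ o, Orb D θ o → ⟪a, o⟫ = 0} : Set V) := by
      rw [h]; exact hθ.root
    exact absurd (this.2 θ Orb.base) (self_pos D hθ.root).ne'

/-- The combinatorial situation: an ideal with nonnegative pairings and a top root. -/
structure Ctx (D : RootSystemData V) (Ψ : Set V) (θ : V) : Prop where
  notG2 : D.NotG2
  top : IsTop D θ
  len : ∀ a ∈ D.roots, ⟪a, a⟫ = ⟪θ, θ⟫ ∨ 2 * ⟪a, a⟫ = ⟪θ, θ⟫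
  ideal : D.CombIdeal Ψ
  nn : ∀ a ∈ Ψ, ∀ b ∈ Ψ, 0 ≤ ⟪a, b⟫

/-- The inner product rescaled so that `θ` has square length `4`. -/
def B (θ u v : V) : ℝ := 4 / ⟪θ, θ⟫ * ⟪u, v⟫

lemma B_add_left (θ u v w : V) : B θ (u + v) w = B θ u w + B θ v w := by
  simp only [B, inner_add_left]; ring
lemma B_add_right (θ u v w : V) : B θ w (u + v) = B θ w u + B θ w v := by
  simp only [B, inner_add_right]; ring
lemma B_sub_left (θ u v w : V) : B θ (u - v) w = B θ u w - B θ v w := by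
  simp only [B, inner_sub_left]; ring
lemma B_sub_right (θ u v w : V) : B θ w (u - v) = B θ w u - B θ w v := by
  simp only [B, inner_sub_right]; ring
lemma B_neg_left (θ u w : V) : B θ (-u) w = - B θ u w := by
  simp only [B, inner_neg_left]; ring
lemma B_neg_right (θ u w : V) : B θ w (-u) = - B θ w u := by
  simp only [B, inner_neg_right]; ring
lemma B_comm (θ u v : V) : B θ u v = B θ v u := by
  simp only [B, real_inner_comm]

/-- Integer version of `B` (meaningful on roots). -/
def I (θ u v : V) : ℤ := ⌊B θ u v⌋

variable {Ψ : Set V} {θ : V}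

lemma Ctx.Npos (C : Ctx D Ψ θ) : 0 < ⟪θ, θ⟫ := self_pos D C.top.root

lemma Ctx.B_top (C : Ctx D Ψ θ) : B θ θ θ = 4 := by
  have := C.Npos
  unfold B; field_simp

lemma Ctx.B_self (C : Ctx D Ψ θ) {a : V} (ha : a ∈ D.roots) : B θ a a = 2 ∨ B θ a a = 4 := by
  have := C.Npos
  rcases C.len a ha with h | h
  · right; unfold B; rw [h]; field_simp
  · left; unfold B
    have e : ⟪a, a⟫ = ⟪θ, θ⟫ / 2 := by linarith
    rw [e]; generalize ⟪θ, θ⟫ = N at *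
    field_simp; norm_num

lemma Ctx.cp (C : Ctx D Ψ θ) {a b : V} (hb : b ∈ D.roots) : cpair a b * B θ b b = 2 * B θ a b := by
  have := cpair_mul D (α := a) hb
  unfold B
  linear_combination 4 / ⟪θ, θ⟫ * this

lemma Ctx.exists_int (C : Ctx D Ψ θ) {a b : V} (ha : a ∈ D.roots) (hb : b ∈ D.roots) :
    ∃ n : ℤ, B θ a b = n ∧ (B θ b b = 4 → 2 ∣ n) := by
  obtain ⟨m, hm⟩ := D.crystallographic a ha b hb
  have h := C.cp (a := a) hb
  rw [hm] at h
  rcases C.B_self hb with h2 | h2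
  · refine ⟨m, by rw [h2] at h; linarith, fun h4 => ?_⟩
    rw [h2] at h4; norm_num at h4
  · refine ⟨2 * m, by rw [h2] at h; push_cast; linarith, fun _ => by simp⟩

lemma Ctx.I_cast (C : Ctx D Ψ θ) {a b : V} (ha : a ∈ D.roots) (hb : b ∈ D.roots) :
    B θ a b = (I θ a b : ℝ) := by
  obtain ⟨n, hn, -⟩ := C.exists_int ha hb
  unfold I; rw [hn]; simp

lemma I_comm (θ a b : V) : I θ a b = I θ b a := by
  unfold I; rw [B_comm]

lemma Ctx.I_self (C : Ctx D Ψ θ) {a : V} (ha : a ∈ D.roots) : I θ a a = 2 ∨ I θ a a = 4 := by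
  unfold I
  rcases C.B_self ha with h | h <;> rw [h] <;> norm_num

lemma Ctx.I_top (C : Ctx D Ψ θ) : I θ θ θ = 4 := by
  unfold I; rw [C.B_top]; norm_num

lemma Ctx.I_even (C : Ctx D Ψ θ) {a b : V} (ha : a ∈ D.roots) (hb : b ∈ D.roots)
    (h : I θ b b = 4) : 2 ∣ I θ a b := by
  obtain ⟨n, hn, h2⟩ := C.exists_int ha hb
  have : I θ a b = n := by unfold I; rw [hn]; simp
  rw [this]
  apply h2
  rw [C.I_cast hb hb, h]; norm_num

lemma Ctx.inner_pos (C : Ctx D Ψ θ) {a b : V} : 0 < B θ a b ↔ 0 < ⟪a, b⟫ := by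
  have := C.Npos
  unfold B
  exact ⟨fun h => pos_of_mul_pos_right h (by positivity), fun h => by positivity⟩

lemma Ctx.I_ne (C : Ctx D Ψ θ) {a b : V} (ha : a ∈ D.roots) (hb : b ∈ D.roots) (hne : a ≠ b) :
    2 * I θ a b ≤ I θ a a ∨ 2 * I θ a b ≤ I θ b b := by
  have h1 := C.I_self ha
  have h2 := C.I_self hb
  by_cases hp : 0 < I θ a b
  · have hp' : 0 < B θ a b := by rw [C.I_cast ha hb]; exact_mod_cast hp
    have hN := C.Npos
    have key : 2 * B θ a b ≤ B θ a a ∨ 2 * B θ a b ≤ B θ b b := by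
      have hc : 0 < 4 / ⟪θ, θ⟫ := by positivity
      unfold B
      rcases pos_pair C.notG2 ha hb (C.inner_pos.1 hp') hne with ⟨h3, h4⟩ | ⟨h3, h4⟩ | ⟨h3, h4⟩
      · left; rw [h3, ← h4]; linarith
      · left; rw [h3, h4]; linarith
      · right; rw [h3, h4]; linarith
    rw [C.I_cast ha hb, C.I_cast hb hb, C.I_cast ha ha] at key
    exact_mod_cast key
  · left; omega

lemma Ctx.root (C : Ctx D Ψ θ) {a : V} (ha : a ∈ Ψ) : a ∈ D.roots := D.pos_subset (C.ideal.1 ha)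

lemma Ctx.B_nn (C : Ctx D Ψ θ) {a b : V} (ha : a ∈ Ψ) (hb : b ∈ Ψ) : 0 ≤ B θ a b := by
  have := C.Npos
  have := C.nn a ha b hb
  unfold B; positivity

lemma Ctx.I_nn (C : Ctx D Ψ θ) {a b : V} (ha : a ∈ Ψ) (hb : b ∈ Ψ) : 0 ≤ I θ a b := by
  have := C.B_nn ha hb
  rw [C.I_cast (C.root ha) (C.root hb)] at this
  exact_mod_cast this

lemma Ctx.B_top_nn (C : Ctx D Ψ θ) {a : V} (ha : a ∈ D.pos) : 0 ≤ B θ θ a := by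
  have := C.Npos
  have := C.top.nonneg ha
  unfold B; positivity

lemma Ctx.eq_zero (C : Ctx D Ψ θ) {v : V} (h : B θ v v ≤ 0) : v = 0 := by
  have := C.Npos
  apply real_inner_self_nonpos.1
  by_contra hc
  have : 0 < B θ v v := C.inner_pos.2 (not_le.1 hc)
  linarith

lemma Ctx.sub_root (C : Ctx D Ψ θ) {a b : V} (ha : a ∈ D.roots) (hb : b ∈ D.roots)
    (h : 0 < B θ a b) (h2 : B θ a b ≠ B θ a a) : a - b ∈ D.roots :=
  sub_mem D ha hb (C.inner_pos.1 h) (by rintro rfl; exact h2 rfl)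

end Lengths

end SphAux

namespace SphAux

section Configs

variable {D : RootSystemData V} {Ψ : Set V} {θ : V}

lemma Ctx.up (C : Ctx D Ψ θ) {a e : V} (ha : a ∈ Ψ) (he : e ∈ D.pos) (h : a + e ∈ D.roots) :
    a + e ∈ Ψ :=
  C.ideal.2 a ha e he (D.pos_add a (C.ideal.1 ha) e he h)

lemma Ctx.up' (C : Ctx D Ψ θ) {a e c : V} (ha : a ∈ Ψ) (he : e ∈ D.pos) (hc : a + e = c)
    (h : c ∈ D.roots) : c ∈ Ψ := by
  subst hc; exact C.up ha he h

/-- A long root of `θ`-degree one and its complement are not both in `Ψ`. -/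
lemma Ctx.compl_false (C : Ctx D Ψ θ) {l : V} (hl : l ∈ Ψ) (h4 : B θ l l = 4) (h2 : B θ θ l = 2)
    (h : θ - l ∈ Ψ) : False := by
  have := C.B_nn h hl
  rw [B_sub_left] at this
  linarith

lemma Ctx.compl_root (C : Ctx D Ψ θ) {l : V} (hl : l ∈ D.roots) (h2 : B θ θ l = 2) :
    θ - l ∈ D.roots :=
  C.sub_root C.top.root hl (by rw [h2]; norm_num) (by rw [h2, C.B_top]; norm_num)

lemma Ctx.config1 (C : Ctx D Ψ θ) {a b c d : V} (ha : a ∈ Ψ) (hb : b ∈ Ψ) (hc : c ∈ Ψ) (hd : d ∈ Ψ)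
    (sa : B θ a a = 4) (sb : B θ b b = 4) (sd : B θ d d = 4)
    (ta : B θ θ a = 2) (tb : B θ θ b = 2) (td : B θ θ d = 2) (nab : B θ a b = 0)
    (hsum : a + b + c + d = θ + θ) : False := by
  have r1 := C.compl_root (C.root ha) ta
  have r2 : θ - a - b ∈ D.roots := by
    have e1 : B θ (θ - a) b = 2 := by rw [B_sub_left]; linarith
    have e2 : B θ (θ - a) (θ - a) = 4 := by
      simp only [B_sub_left, B_sub_right]
      linarith [C.B_top, B_comm θ a θ]
    exact C.sub_root r1 (C.root hb) (by rw [e1]; norm_num) (by rw [e1, e2]; norm_num)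
  rcases pos_or D r2 with hp | hp
  · exact C.compl_false hb sb tb (C.up' ha hp (by abel) (C.compl_root (C.root hb) tb))
  · refine C.compl_false hd sd td (C.up' hc hp ?_ (C.compl_root (C.root hd) td))
    have : d = θ + θ - a - b - c := by rw [← hsum]; abel
    rw [this]; abel

lemma Ctx.config2 (C : Ctx D Ψ θ) {a b c : V} (ha : a ∈ Ψ) (hb : b ∈ Ψ) (hc : c ∈ Ψ)
    (sa : B θ a a = 4) (sb : B θ b b = 4) (sc : B θ c c = 2)
    (ta : B θ θ a = 2) (tb : B θ θ b = 2) (tc : B θ θ c = 2)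
    (nab : B θ a b = 0) (nac : B θ a c = 0) (nbc : B θ b c = 0) : False := by
  have hsum : a + b + c + c - θ - θ = 0 := by
    apply C.eq_zero
    simp only [B_sub_left, B_sub_right, B_add_left, B_add_right]
    linarith [C.B_top, B_comm θ a θ, B_comm θ b θ, B_comm θ c θ, B_comm θ b a, B_comm θ c a,
      B_comm θ c b]
  have rf := C.compl_root (C.root hc) tc
  have rg : a - (θ - c) ∈ D.roots := by
    have e : B θ a (θ - c) = 2 := by rw [B_sub_right, B_comm]; linarith
    exact C.sub_root (C.root ha) rf (by rw [e]; norm_num) (by rw [e, sa]; norm_num)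
  rcases pos_or D rg with hp | hp
  · refine C.compl_false hb sb tb (C.up' hc hp ?_ (C.compl_root (C.root hb) tb))
    rw [← sub_eq_zero, ← hsum]; abel
  · exact C.compl_false ha sa ta (C.up' hc hp (by abel) (C.compl_root (C.root ha) ta))

lemma Ctx.config3 (C : Ctx D Ψ θ) {a b c d : V} (ha : a ∈ Ψ) (hb : b ∈ Ψ) (hc : c ∈ Ψ) (hd : d ∈ Ψ)
    (sa : B θ a a = 2) (sb : B θ b b = 2) (sc : B θ c c = 2) (sd : B θ d d = 4)
    (ta : B θ θ a = 2) (tb : B θ θ b = 2) (tc : B θ θ c = 2) (td : B θ θ d = 2)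
    (nab : B θ a b = 1) (nac : B θ a c = 1) (nbc : B θ b c = 1)
    (nad : B θ a d = 0) (nbd : B θ b d = 0) (ncd : B θ c d = 0) : False := by
  have t0 := C.B_top
  have hsum : a + b + c + d - θ - θ = 0 := by
    apply C.eq_zero
    simp only [B_sub_left, B_sub_right, B_add_left, B_add_right]
    linarith [C.B_top, B_comm θ a θ, B_comm θ b θ, B_comm θ c θ, B_comm θ d θ, B_comm θ b a,
      B_comm θ c a, B_comm θ c b, B_comm θ d a, B_comm θ d b, B_comm θ d c]
  -- for each of the three short roots `x` (with others `y`, `z`) the root `θ - y - z` is positive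
  have key : ∀ x ∈ Ψ, ∀ y ∈ Ψ, ∀ z ∈ Ψ, B θ x x = 2 → B θ y y = 2 → B θ θ x = 2 → B θ θ y = 2 →
      B θ θ z = 2 → B θ y z = 1 → B θ x d = 0 → x + y + z + d - θ - θ = 0 →
      x + θ - y - z ∈ Ψ := by
    intro x hx y hy z hz sx sy tx ty tz nyz nxd hs
    have r1 := C.compl_root (C.root hy) ty
    have r2 : θ - y - z ∈ D.roots := by
      have e : B θ (θ - y) z = 1 := by rw [B_sub_left]; linarith
      have e2 : B θ (θ - y) (θ - y) = 2 := by
        simp only [B_sub_left, B_sub_right]; linarith [B_comm θ y θ]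
      exact C.sub_root r1 (C.root hz) (by rw [e]; norm_num) (by rw [e, e2]; norm_num)
    rcases pos_or D r2 with hp | hp
    · refine C.up' hx hp (by abel) ?_
      -- `θ - 2 x` is a root
      have r3 : θ - x - x ∈ D.roots := by
        have := refl_mem' D C.top.root (C.root hx)
        have hcp : cpair θ x = 2 := by
          have := C.cp (a := θ) (C.root hx)
          rw [sx, tx] at this; linarith
        rw [hcp, two_smul] at this
        rwa [sub_sub]
      have e : B θ d (θ - x - x) = 2 := by
        simp only [B_sub_right]; linarith [B_comm θ d θ, B_comm θ d x]
      have r4 := C.sub_root (C.root hd) r3 (by rw [e]; norm_num) (by rw [e, sd]; norm_num)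
      have e5 : x + θ - y - z = d - (θ - x - x) := by
        rw [← sub_eq_zero, ← neg_eq_zero, ← hs]; abel
      rw [e5]; exact r4
    · exfalso
      refine C.compl_false hd sd td (C.up' hx hp ?_ (C.compl_root (C.root hd) td))
      rw [← sub_eq_zero, ← hs]; abel
  have kb := key b hb a ha c hc sb sa tb ta tc nac nbd (by rw [← hsum]; abel)
  have kc := key c hc a ha b hb sc sa tc ta tb nab ncd (by rw [← hsum]; abel)
  have fin : ∀ l ∈ Ψ, B θ l l = 4 → B θ θ l = 2 → ∀ e ∈ D.pos, a + e = θ - l → False := by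
    intro l hl h4 h2 e he hh
    exact C.compl_false hl h4 h2 (C.up' ha he hh (C.compl_root (C.root hl) h2))
  have r : b - c ∈ D.roots :=
    C.sub_root (C.root hb) (C.root hc) (by rw [nbc]; norm_num) (by rw [nbc, sb]; norm_num)
  have cm := B_comm θ a θ
  have cm2 := B_comm θ b θ
  have cm3 := B_comm θ c θ
  have cm4 := B_comm θ b a
  have cm5 := B_comm θ c a
  have cm6 := B_comm θ c b
  rcases pos_or D r with hp | hp
  · refine fin _ kc ?_ ?_ _ hp (by abel)
    · simp only [B_sub_left, B_sub_right, B_add_left, B_add_right]; linarith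
    · simp only [B_sub_right, B_add_right]; linarith
  · refine fin _ kb ?_ ?_ _ hp (by abel)
    · simp only [B_sub_left, B_sub_right, B_add_left, B_add_right]; linarith
    · simp only [B_sub_right, B_add_right]; linarith

/-- If the sum of two elements of `Ψ` is a root, both are short and they are orthogonal. -/
lemma Ctx.add_root (C : Ctx D Ψ θ) {a b : V} (ha : a ∈ Ψ) (hb : b ∈ Ψ) (h : a + b ∈ D.roots) :
    B θ a a = 2 ∧ B θ b b = 2 ∧ B θ a b = 0 ∧ B θ (a + b) (a + b) = 4 := by
  have h1 := C.B_nn ha hb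
  have e : B θ (a + b) (a + b) = B θ a a + B θ b b + 2 * B θ a b := by
    simp only [B_add_left, B_add_right]; linarith [B_comm θ b a]
  have h2 := C.B_self h
  rcases C.B_self (C.root ha) with h3 | h3 <;> rcases C.B_self (C.root hb) with h4 | h4 <;>
    rcases h2 with h2 | h2 <;> first | (exfalso; linarith) | (refine ⟨h3, h4, ?_, h2⟩; linarith)

/-- `Ψ` has no chains of three summable roots. -/
lemma Ctx.class_two (C : Ctx D Ψ θ) {a b c : V} (ha : a ∈ Ψ) (hb : b ∈ Ψ) (hc : c ∈ Ψ)
    (h : a + b ∈ D.roots) : c + (a + b) ∉ D.roots := by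
  intro h'
  have hab : a + b ∈ Ψ := C.up ha (C.ideal.1 hb) h
  have h1 := C.add_root ha hb h
  have h2 := C.add_root hc hab h'
  linarith [h1.2.2.2, h2.2.1]

/-- Two orthogonal short roots of degree one add up to `θ`. -/
lemma Ctx.add_eq_top (C : Ctx D Ψ θ) {a b : V} (sa : B θ a a = 2) (sb : B θ b b = 2)
    (ta : B θ θ a = 2) (tb : B θ θ b = 2) (nab : B θ a b = 0) : a + b = θ := by
  rw [← sub_eq_zero]
  apply C.eq_zero
  simp only [B_sub_left, B_sub_right, B_add_left, B_add_right]
  linarith [C.B_top, B_comm θ a θ, B_comm θ b θ, B_comm θ b a]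

lemma Ctx.eq_of (C : Ctx D Ψ θ) {a b : V} (sa : B θ a a = 2) (sb : B θ b b = 2)
    (nab : B θ a b = 2) : a = b := by
  rw [← sub_eq_zero]
  apply C.eq_zero
  simp only [B_sub_left, B_sub_right]
  linarith [B_comm θ b a]

/-- If `a`, `b` are short, orthogonal and `a + b` is a root, so is `a - b`. -/
lemma Ctx.diff_root (C : Ctx D Ψ θ) {a b : V} (hb : b ∈ D.roots)
    (sb : B θ b b = 2) (nab : B θ a b = 0) (h : a + b ∈ D.roots) : a - b ∈ D.roots := by
  have := refl_mem' D h hb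
  have hcp : cpair (a + b) b = 2 := by
    have := C.cp (a := a + b) hb
    rw [sb, B_add_left, nab, sb] at this; linarith
  rw [hcp, two_smul] at this
  convert this using 1
  abel

/-- A vector whose square length is not `2` or `4` is not a root. -/
lemma Ctx.not_root (C : Ctx D Ψ θ) {v : V} (h2 : B θ v v ≠ 2) (h4 : B θ v v ≠ 4) :
    v ∉ D.roots := fun h => (C.B_self h).elim h2 h4

end Configs

end SphAux

namespace SphAux

section Sym

variable {R : Type*} [Ring R]

/-- Symmetrized product of two elements. -/
def S2 (a b : R) : R := a * b + b * a
/-- Symmetrized product of three elements. -/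
def S3 (a b c : R) : R := a * S2 b c + b * S2 a c + c * S2 a b
/-- Symmetrized product of four elements. -/
def S4 (a b c d : R) : R := a * S3 b c d + b * S3 a c d + c * S3 a b d + d * S3 a b c

lemma S2_swap (a b : R) : S2 b a = S2 a b := by unfold S2; abel
lemma S3_swap12 (a b c : R) : S3 b a c = S3 a b c := by
  unfold S3; rw [S2_swap a b]; abel
lemma S3_swap23 (a b c : R) : S3 a c b = S3 a b c := by
  unfold S3; rw [S2_swap b c]; abel
lemma S4_swap12 (a b c d : R) : S4 b a c d = S4 a b c d := by
  unfold S4; rw [S3_swap12 a b c, S3_swap12 a b d]; abel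
lemma S4_swap23 (a b c d : R) : S4 a c b d = S4 a b c d := by
  unfold S4; rw [S3_swap23 a b c, S3_swap12 b c d]; abel
lemma S4_swap34 (a b c d : R) : S4 a b d c = S4 a b c d := by
  unfold S4; rw [S3_swap23 a c d, S3_swap23 b c d]; abel

lemma S2_lie (e a b : R) : e * S2 a b - S2 a b * e = S2 (e * a - a * e) b + S2 a (e * b - b * e) := by
  unfold S2; noncomm_ring

lemma S3_lie (e a b c : R) : e * S3 a b c - S3 a b c * e =
    S3 (e * a - a * e) b c + S3 a (e * b - b * e) c + S3 a b (e * c - c * e) := by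
  have h1 := S2_lie e b c
  have h2 := S2_lie e a c
  have h3 := S2_lie e a b
  have : e * S3 a b c - S3 a b c * e =
      (e * a - a * e) * S2 b c + a * (e * S2 b c - S2 b c * e) +
      ((e * b - b * e) * S2 a c + b * (e * S2 a c - S2 a c * e)) +
      ((e * c - c * e) * S2 a b + c * (e * S2 a b - S2 a b * e)) := by
    unfold S3; noncomm_ring
  rw [this, h1, h2, h3]
  unfold S3
  simp only [mul_add]
  abel

lemma S4_lie (e a b c d : R) : e * S4 a b c d - S4 a b c d * e =
    S4 (e * a - a * e) b c d + S4 a (e * b - b * e) c d + S4 a b (e * c - c * e) d +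
      S4 a b c (e * d - d * e) := by
  have h1 := S3_lie e b c d
  have h2 := S3_lie e a c d
  have h3 := S3_lie e a b d
  have h4 := S3_lie e a b c
  have : e * S4 a b c d - S4 a b c d * e =
      (e * a - a * e) * S3 b c d + a * (e * S3 b c d - S3 b c d * e) +
      ((e * b - b * e) * S3 a c d + b * (e * S3 a c d - S3 a c d * e)) +
      ((e * c - c * e) * S3 a b d + c * (e * S3 a b d - S3 a b d * e)) +
      ((e * d - d * e) * S3 a b c + d * (e * S3 a b c - S3 a b c * e)) := by
    unfold S4; noncomm_ring
  rw [this, h1, h2, h3, h4]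
  unfold S4
  simp only [mul_add]
  abel

lemma S4_self (a : R) : S4 a a a a = 24 * a ^ 4 := by
  unfold S4 S3 S2; noncomm_ring

lemma S4_add (a a' b c d : R) : S4 (a + a') b c d = S4 a b c d + S4 a' b c d := by
  simp only [S4, S3, S2, add_mul, mul_add]; abel

lemma S4_zero (b c d : R) : S4 0 b c d = 0 := by simp [S4, S3, S2]

lemma S4_smul {k : Type*} [CommRing k] [Algebra k R] (r : k) (a b c d : R) :
    S4 (r • a) b c d = r • S4 a b c d := by
  simp only [S4, S3, S2, smul_mul_assoc, mul_smul_comm, smul_add, mul_add]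

lemma S4_swap13 (a b c d : R) : S4 c b a d = S4 a b c d := by
  rw [S4_swap12 b c, S4_swap23 b a, S4_swap12 a b]
lemma S4_swap14 (a b c d : R) : S4 d b c a = S4 a b c d := by
  rw [S4_swap34 d b a c, S4_swap13 a b d c, S4_swap34 a b c d]

lemma S4_smul2 {k : Type*} [CommRing k] [Algebra k R] (r : k) (a b c d : R) :
    S4 a (r • b) c d = r • S4 a b c d := by rw [S4_swap12, S4_smul, S4_swap12]
lemma S4_smul3 {k : Type*} [CommRing k] [Algebra k R] (r : k) (a b c d : R) :
    S4 a b (r • c) d = r • S4 a b c d := by rw [S4_swap13, S4_smul, S4_swap13]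
lemma S4_smul4 {k : Type*} [CommRing k] [Algebra k R] (r : k) (a b c d : R) :
    S4 a b c (r • d) = r • S4 a b c d := by rw [S4_swap14, S4_smul, S4_swap14]

/-- If `d` commutes with `a`, `b`, `c`, it can be moved to the right. -/
lemma S4_comm (a b c d : R) (ha : d * a = a * d) (hb : d * b = b * d) (hc : d * c = c * d) :
    S4 a b c d = 4 * S3 a b c * d := by
  have e2 : ∀ x y : R, d * x = x * d → d * y = y * d → S3 x y d = 3 * S2 x y * d := by
    intro x y hx hy
    have : S3 x y d = x * (d * y) + x * y * d + (y * x * d + y * (d * x)) +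
      ((d * x) * y + (d * y) * x) := by unfold S3 S2; noncomm_ring
    rw [this, hx, hy]
    have : x * d * y + y * d * x = x * (d * y) + y * (d * x) := by noncomm_ring
    rw [this, hx, hy]
    unfold S2; noncomm_ring
  have e3 : d * S3 a b c = S3 a b c * d := by
    have := S3_lie d a b c
    rw [ha, hb, hc, sub_self, sub_self, sub_self] at this
    simpa [S3, S2, sub_eq_zero] using this
  rw [S4, e2 b c hb hc, e2 a c ha hc, e2 a b ha hb, e3]
  unfold S3; noncomm_ring

end Sym

section Lie

variable {L : Type*} [LieRing L] [LieAlgebra ℂ L] (D : LieRootData V L)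

open Classical in
/-- The homogeneous piece of degree `v`. -/
def G (v : V) : Submodule ℂ L :=
  if v ∈ D.roots then D.rs v else if v = 0 then D.cartan.toSubmodule else ⊥

lemma G_root {v : V} (h : v ∈ D.roots) : G D v = D.rs v := by simp [G, h]

lemma zero_not_root (R : RootSystemData V) : (0 : V) ∉ R.roots := fun h => R.ne_zero 0 h rfl

lemma G_zero : G D (0 : V) = D.cartan.toSubmodule := by
  have := zero_not_root D.toRootSystemData
  simp [G, this]

lemma G_bot {v : V} (h : v ∉ D.roots) (h0 : v ≠ 0) : G D v = ⊥ := by simp [G, h, h0]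

lemma G_lie {a v : V} (ha : a ∈ D.roots) {x y : L} (hx : x ∈ D.rs a) (hy : y ∈ G D v) :
    ⁅x, y⁆ ∈ G D (a + v) := by
  by_cases hv : v ∈ D.roots
  · rw [G_root D hv] at hy
    by_cases hs : a + v ∈ D.roots
    · rw [G_root D hs]; exact D.bracket_mem a ha v hv hs x hx y hy
    by_cases h0 : a + v = 0
    · have : v = -a := by rw [eq_neg_iff_add_eq_zero, add_comm]; exact h0
      subst this
      rw [h0, G_zero]
      exact D.bracket_cartan_mem a ha x hx y hy
    · rw [D.bracket_eq_zero a ha v hv hs h0 x hx y hy]; exact Submodule.zero_mem _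
  by_cases h0 : v = 0
  · subst h0
    rw [G_zero] at hy
    rw [add_zero, G_root D ha]
    obtain ⟨c, hc⟩ := D.weight_vec a ha y hy x hx
    rw [← lie_skew, hc]
    exact Submodule.neg_mem _ (Submodule.smul_mem _ _ hx)
  · rw [G_bot D hv h0] at hy
    rw [(Submodule.mem_bot ℂ).1 hy, lie_zero]; exact Submodule.zero_mem _

lemma ad_commute {a b : V} (ha : a ∈ D.roots) (hb : b ∈ D.roots) (h : a + b ∉ D.roots)
    (h0 : a + b ≠ 0) {x y : L} (hx : x ∈ D.rs a) (hy : y ∈ D.rs b) :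
    LieAlgebra.ad ℂ L x * LieAlgebra.ad ℂ L y = LieAlgebra.ad ℂ L y * LieAlgebra.ad ℂ L x := by
  have := D.bracket_eq_zero a ha b hb h h0 x hx y hy
  refine LinearMap.ext fun z => ?_
  simp only [Module.End.mul_apply, LieAlgebra.ad_apply]
  rw [leibniz_lie x y z, this, zero_lie, zero_add]

lemma ad_lie' (x y : L) :
    LieAlgebra.ad ℂ L x * LieAlgebra.ad ℂ L y - LieAlgebra.ad ℂ L y * LieAlgebra.ad ℂ L x =
      LieAlgebra.ad ℂ L ⁅x, y⁆ := by
  refine LinearMap.ext fun z => ?_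
  simp only [LinearMap.sub_apply, Module.End.mul_apply, LieAlgebra.ad_apply]
  rw [leibniz_lie x y z]; abel

/-- A word of four root vectors is homogeneous. -/
lemma word_mem {a b c d v w : V} {x1 x2 x3 x4 y : L}
    (h1 : x1 ∈ D.rs a) (h2 : x2 ∈ D.rs b) (h3 : x3 ∈ D.rs c)
    (h4 : x4 ∈ D.rs d) (ha : a ∈ D.roots) (hb : b ∈ D.roots) (hc : c ∈ D.roots)
    (hd : d ∈ D.roots) (hy : y ∈ G D v) (hw : a + b + c + d + v = w) :
    ⁅x1, ⁅x2, ⁅x3, ⁅x4, y⁆⁆⁆⁆ ∈ G D w := by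
  have := G_lie D ha h1 (G_lie D hb h2 (G_lie D hc h3 (G_lie D hd h4 hy)))
  rw [← hw]
  convert this using 1
  abel_nf

lemma S4_mem {a b c d v : V} (ha : a ∈ D.roots) (hb : b ∈ D.roots) (hc : c ∈ D.roots)
    (hd : d ∈ D.roots) {x1 x2 x3 x4 y : L} (h1 : x1 ∈ D.rs a) (h2 : x2 ∈ D.rs b) (h3 : x3 ∈ D.rs c)
    (h4 : x4 ∈ D.rs d) (hy : y ∈ G D v) :
    S4 (LieAlgebra.ad ℂ L x1) (LieAlgebra.ad ℂ L x2) (LieAlgebra.ad ℂ L x3) (LieAlgebra.ad ℂ L x4) y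
      ∈ G D (a + b + c + d + v) := by
  simp only [S4, S3, S2, mul_add, LinearMap.add_apply, Module.End.mul_apply, LieAlgebra.ad_apply]
  repeat' apply Submodule.add_mem
  all_goals
    apply word_mem D (v := v)
    any_goals assumption
    abel

/-- Vanishing of all symmetrized words of type `a, b, c, d` on the root space of `-θ`. -/
def Z (θ a b c d : V) : Prop :=
  ∀ x1 ∈ D.rs a, ∀ x2 ∈ D.rs b, ∀ x3 ∈ D.rs c, ∀ x4 ∈ D.rs d, ∀ y ∈ D.rs (-θ),
    S4 (LieAlgebra.ad ℂ L x1) (LieAlgebra.ad ℂ L x2) (LieAlgebra.ad ℂ L x3)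
      (LieAlgebra.ad ℂ L x4) y = 0

variable {D}

lemma Z.swap12 {θ a b c d : V} (h : Z D θ a b c d) : Z D θ b a c d :=
  fun x1 h1 x2 h2 x3 h3 x4 h4 y hy => by
    rw [S4_swap12]; exact h x2 h2 x1 h1 x3 h3 x4 h4 y hy
lemma Z.swap23 {θ a b c d : V} (h : Z D θ a b c d) : Z D θ a c b d :=
  fun x1 h1 x2 h2 x3 h3 x4 h4 y hy => by
    rw [S4_swap23]; exact h x1 h1 x3 h3 x2 h2 x4 h4 y hy
lemma Z.swap34 {θ a b c d : V} (h : Z D θ a b c d) : Z D θ a b d c :=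
  fun x1 h1 x2 h2 x3 h3 x4 h4 y hy => by
    rw [S4_swap34]; exact h x1 h1 x2 h2 x4 h4 x3 h3 y hy

variable {Ψ : Set V} {θ : V}

/-- Weight argument. -/
lemma Z_of_weight (C : Ctx D.toRootSystemData Ψ θ) {a b c d : V} (ha : a ∈ Ψ) (hb : b ∈ Ψ)
    (hc : c ∈ Ψ) (hd : d ∈ Ψ) (h : a + b + c + d - θ ∉ D.roots) (h0 : a + b + c + d - θ ≠ 0) :
    Z D θ a b c d := by
  intro x1 h1 x2 h2 x3 h3 x4 h4 y hy
  rw [← G_root D (neg_mem _ C.top.root)] at hy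
  have := S4_mem D (C.root ha) (C.root hb) (C.root hc) (C.root hd) h1 h2 h3 h4 hy
  rw [← sub_eq_add_neg, G_bot D h h0] at this
  exact (Submodule.mem_bot ℂ).1 this

lemma neg_top_add (C : Ctx D.toRootSystemData Ψ θ) {e : V} (he : e ∈ D.pos) (ht : B θ θ e = 0) :
    e + -θ ∉ D.roots ∧ e + -θ ≠ 0 := by
  constructor
  · intro h
    have h1 := neg_mem _ h
    rw [neg_add, neg_neg, add_comm, ← sub_eq_add_neg] at h1
    have r := refl_mem' _ h1 (D.pos_subset he)
    have hcp : cpair (θ - e) e = -2 := by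
      have h1 := C.cp (a := θ - e) (D.pos_subset he)
      rw [B_sub_left, ht] at h1
      rcases C.B_self (D.pos_subset he) with h2 | h2 <;> rw [h2] at h1 <;> linarith
    rw [hcp] at r
    apply C.top.top e he
    convert r using 1
    rw [neg_smul, two_smul]; abel
  · intro h
    have : θ = e := by rw [← sub_eq_zero, ← neg_eq_zero, ← h]; abel
    rw [← this, C.B_top] at ht
    norm_num at ht

/-- Degree zero roots annihilate the lowest root space. -/
lemma kill (C : Ctx D.toRootSystemData Ψ θ) {e : V} (he : e ∈ D.pos) (ht : B θ θ e = 0) {x y : L}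
    (hx : x ∈ D.rs e) (hy : y ∈ D.rs (-θ)) : ⁅x, y⁆ = 0 := by
  rw [← G_root D (neg_mem _ C.top.root)] at hy
  have := G_lie D (D.pos_subset he) hx hy
  have h := neg_top_add C he ht
  rw [G_bot D h.1 h.2] at this
  exact (Submodule.mem_bot ℂ).1 this

lemma Z_of_comm (C : Ctx D.toRootSystemData Ψ θ) {a b c d : V} (ha : a ∈ Ψ) (hb : b ∈ Ψ)
    (hc : c ∈ Ψ) (hd : d ∈ Ψ) (td : B θ θ d = 0) (h1 : a + d ∉ D.roots) (h2 : b + d ∉ D.roots)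
    (h3 : c + d ∉ D.roots) : Z D θ a b c d := by
  intro x1 hx1 x2 hx2 x3 hx3 x4 hx4 y hy
  have key : ∀ p ∈ Ψ, p + d ∉ D.roots → ∀ x ∈ D.rs p,
      LieAlgebra.ad ℂ L x4 * LieAlgebra.ad ℂ L x = LieAlgebra.ad ℂ L x * LieAlgebra.ad ℂ L x4 := by
    intro p hp hpd x hx
    rw [add_comm] at hpd
    exact ad_commute D (C.root hd) (C.root hp) hpd
      (pos_add_ne _ (C.ideal.1 hd) (C.ideal.1 hp)) hx4 hx
  rw [S4_comm _ _ _ _ (key a ha h1 x1 hx1) (key b hb h2 x2 hx2) (key c hc h3 x3 hx3),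
    Module.End.mul_apply, LieAlgebra.ad_apply, kill C (C.ideal.1 hd) td hx4 hy, map_zero]

/-- Root spaces are lines. -/
lemma rs_line (D : LieRootData V L) {a : V} (ha : a ∈ D.roots) :
    ∃ x ∈ D.rs a, x ≠ 0 ∧ ∀ z ∈ D.rs a, ∃ c : ℂ, z = c • x := by
  obtain ⟨v, hv, h⟩ := finrank_eq_one_iff'.1 (D.rs_dim a ha)
  refine ⟨v, v.2, by simpa using hv, fun z hz => ?_⟩
  obtain ⟨c, hc⟩ := h ⟨z, hz⟩
  exact ⟨c, by simpa using (congrArg Subtype.val hc).symm⟩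

lemma rs_line' (D : LieRootData V L) {a : V} (ha : a ∈ D.roots) {x : L} (hx : x ∈ D.rs a)
    (h0 : x ≠ 0) {z : L} (hz : z ∈ D.rs a) : ∃ c : ℂ, z = c • x := by
  obtain ⟨v, hv, hv0, h⟩ := rs_line D ha
  obtain ⟨c, hc⟩ := h x hx
  obtain ⟨e, he⟩ := h z hz
  have hc0 : c ≠ 0 := by rintro rfl; exact h0 (by rw [hc, zero_smul])
  exact ⟨e * c⁻¹, by rw [hc, smul_smul, mul_assoc, inv_mul_cancel₀ hc0, mul_one, he]⟩

/-- The derivation trick. -/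
lemma Z_trick (C : Ctx D.toRootSystemData Ψ θ) {a' e a p q r : V} (ha' : a' ∈ Ψ) (hp : p ∈ Ψ)
    (hq : q ∈ Ψ) (hr : r ∈ Ψ) (he : e ∈ D.pos) (hte : B θ θ e = 0) (hae : e + a' = a)
    (ha : a ∈ D.roots) (hZ : Z D θ a' p q r)
    (cp : p = a' ∨ e + p ∉ D.roots) (cq : q = a' ∨ e + q ∉ D.roots)
    (cr : r = a' ∨ e + r ∉ D.roots) : Z D θ a p q r := by
  intro x1 h1 x2 h2 x3 h3 x4 h4 y hy
  have her := D.pos_subset he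
  obtain ⟨E, hE, hE0, -⟩ := rs_line D her
  obtain ⟨x, hx, hx0, hxl⟩ := rs_line D (C.root ha')
  have hEx : ⁅E, x⁆ ∈ D.rs a := by
    rw [← hae]; exact D.bracket_mem e her a' (C.root ha') (by rw [hae]; exact ha) E hE x hx
  have hEx0 : ⁅E, x⁆ ≠ 0 :=
    D.bracket_ne_zero e her a' (C.root ha') (by rw [hae]; exact ha) E hE hE0 x hx hx0
  obtain ⟨k, rfl⟩ := rs_line' D ha hEx hEx0 h1
  -- each of the other three vectors is a multiple of `x` or commutes with `E`
  have alt : ∀ u ∈ Ψ, (u = a' ∨ e + u ∉ D.roots) → ∀ z ∈ D.rs u,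
      (∃ c : ℂ, z = c • x) ∨ ⁅E, z⁆ = 0 := by
    rintro u hu (rfl | hcu) z hz
    · left; exact hxl z hz
    · right
      exact D.bracket_eq_zero e her u (C.root hu) hcu (pos_add_ne _ he (C.ideal.1 hu)) E hE z hz
  have hl := S4_lie (LieAlgebra.ad ℂ L E) (LieAlgebra.ad ℂ L x) (LieAlgebra.ad ℂ L x2)
    (LieAlgebra.ad ℂ L x3) (LieAlgebra.ad ℂ L x4)
  simp only [ad_lie'] at hl
  have hl2 := LinearMap.congr_fun hl y
  rw [LinearMap.sub_apply, Module.End.mul_apply, Module.End.mul_apply, LieAlgebra.ad_apply ℂ L E y,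
    kill C he hte hE hy, hZ x hx x2 h2 x3 h3 x4 h4 y hy, map_zero, map_zero, sub_zero] at hl2
  simp only [LinearMap.add_apply] at hl2
  set T := S4 (LieAlgebra.ad ℂ L ⁅E, x⁆) (LieAlgebra.ad ℂ L x2) (LieAlgebra.ad ℂ L x3)
    (LieAlgebra.ad ℂ L x4) y with hT
  have t2 : S4 (LieAlgebra.ad ℂ L x) (LieAlgebra.ad ℂ L ⁅E, x2⁆) (LieAlgebra.ad ℂ L x3)
      (LieAlgebra.ad ℂ L x4) y = T ∨ S4 (LieAlgebra.ad ℂ L x) (LieAlgebra.ad ℂ L ⁅E, x2⁆)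
      (LieAlgebra.ad ℂ L x3) (LieAlgebra.ad ℂ L x4) y = 0 := by
    rcases alt p hp cp x2 h2 with ⟨c, rfl⟩ | h
    · left
      rw [hT, lie_smul, map_smul, map_smul, S4_swap12, S4_smul, S4_swap12, ← S4_smul,
        S4_swap12]
    · right; rw [h, map_zero, S4_swap12, S4_zero]; rfl
  have t3 : S4 (LieAlgebra.ad ℂ L x) (LieAlgebra.ad ℂ L x2) (LieAlgebra.ad ℂ L ⁅E, x3⁆)
      (LieAlgebra.ad ℂ L x4) y = T ∨ S4 (LieAlgebra.ad ℂ L x) (LieAlgebra.ad ℂ L x2)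
      (LieAlgebra.ad ℂ L ⁅E, x3⁆) (LieAlgebra.ad ℂ L x4) y = 0 := by
    rcases alt q hq cq x3 h3 with ⟨c, rfl⟩ | h
    · left
      rw [hT, lie_smul, map_smul, map_smul, S4_smul3, S4_smul3, S4_swap13]
    · right; rw [h, map_zero, S4_swap23, S4_swap12, S4_zero]; rfl
  have t4 : S4 (LieAlgebra.ad ℂ L x) (LieAlgebra.ad ℂ L x2) (LieAlgebra.ad ℂ L x3)
      (LieAlgebra.ad ℂ L ⁅E, x4⁆) y = T ∨ S4 (LieAlgebra.ad ℂ L x) (LieAlgebra.ad ℂ L x2)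
      (LieAlgebra.ad ℂ L x3) (LieAlgebra.ad ℂ L ⁅E, x4⁆) y = 0 := by
    rcases alt r hr cr x4 h4 with ⟨c, rfl⟩ | h
    · left
      rw [hT, lie_smul, map_smul, map_smul, S4_smul4, S4_smul4, S4_swap14]
    · right; rw [h, map_zero, S4_swap34, S4_swap23, S4_swap12, S4_zero]; rfl
  have hT0 : T = 0 := by
    have : ∃ m : ℕ, ((m + 1 : ℕ) : ℂ) • T = 0 := by
      rcases t2 with t2 | t2 <;> rcases t3 with t3 | t3 <;> rcases t4 with t4 | t4 <;>
        rw [t2, t3, t4] at hl2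
      · exact ⟨3, by rw [hl2]; push_cast; module⟩
      · exact ⟨2, by rw [hl2]; push_cast; module⟩
      · exact ⟨2, by rw [hl2]; push_cast; module⟩
      · exact ⟨1, by rw [hl2]; push_cast; module⟩
      · exact ⟨2, by rw [hl2]; push_cast; module⟩
      · exact ⟨1, by rw [hl2]; push_cast; module⟩
      · exact ⟨1, by rw [hl2]; push_cast; module⟩
      · exact ⟨0, by rw [hl2]; push_cast; module⟩
    obtain ⟨m, hm⟩ := this
    exact (smul_eq_zero.1 hm).resolve_left (by exact_mod_cast Nat.succ_ne_zero m)
  rw [map_smul, S4_smul, LinearMap.smul_apply, ← hT, hT0, smul_zero]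

end Lie

end SphAux

namespace SphAux

section Cases

variable {D : RootSystemData V} {Ψ : Set V} {θ : V}

lemma Ctx.B0 (C : Ctx D Ψ θ) {a b : V} (ha : a ∈ D.roots) (hb : b ∈ D.roots) (h : I θ a b = 0) :
    B θ a b = 0 := by rw [C.I_cast ha hb, h]; norm_num
lemma Ctx.B1 (C : Ctx D Ψ θ) {a b : V} (ha : a ∈ D.roots) (hb : b ∈ D.roots) (h : I θ a b = 1) :
    B θ a b = 1 := by rw [C.I_cast ha hb, h]; norm_num
lemma Ctx.B2 (C : Ctx D Ψ θ) {a b : V} (ha : a ∈ D.roots) (hb : b ∈ D.roots) (h : I θ a b = 2) :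
    B θ a b = 2 := by rw [C.I_cast ha hb, h]; norm_num
lemma Ctx.B4 (C : Ctx D Ψ θ) {a b : V} (ha : a ∈ D.roots) (hb : b ∈ D.roots) (h : I θ a b = 4) :
    B θ a b = 4 := by rw [C.I_cast ha hb, h]; norm_num

/-- If `a + b = c` in the root lattice then `I` is additive. -/
lemma Ctx.I_sum (C : Ctx D Ψ θ) {a b c x : V} (ha : a ∈ D.roots) (hb : b ∈ D.roots)
    (hc : c ∈ D.roots) (hx : x ∈ D.roots) (h : a + b = c) : I θ a x + I θ b x = I θ c x := by
  have : B θ a x + B θ b x = B θ c x := by rw [← h, B_add_left]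
  rw [C.I_cast ha hx, C.I_cast hb hx, C.I_cast hc hx] at this
  exact_mod_cast this

/-- Constraints on a pair. -/
lemma Ctx.pair (C : Ctx D Ψ θ) {a b : V} (ha : a ∈ Ψ) (hb : b ∈ Ψ) :
    0 ≤ I θ a b ∧ (I θ a a = 4 → I θ a b % 2 = 0) ∧ (I θ b b = 4 → I θ a b % 2 = 0) := by
  refine ⟨C.I_nn ha hb, fun h => ?_, fun h => ?_⟩
  · have := C.I_even (C.root hb) (C.root ha) h
    rw [I_comm] at this; omega
  · have := C.I_even (C.root ha) (C.root hb) h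
    omega

end Cases

section CasesZ

variable {L : Type*} [LieRing L] [LieAlgebra ℂ L] {D : LieRootData V L} {Ψ : Set V} {θ : V}

lemma Z_of_norm (C : Ctx D.toRootSystemData Ψ θ) {a b c d w : V} (ha : a ∈ Ψ) (hb : b ∈ Ψ)
    (hc : c ∈ Ψ) (hd : d ∈ Ψ) (hw : a + b + c + d - θ = w) (h : 4 < B θ w w) : Z D θ a b c d := by
  apply Z_of_weight C ha hb hc hd
  · rw [hw]; exact C.not_root (by linarith) (by linarith)
  · rw [hw]; rintro rfl
    simp [B] at h
    linarith

lemma nr (C : Ctx D.toRootSystemData Ψ θ) {w : V} (h : 4 < B θ w w) : w ∉ D.roots :=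
  C.not_root (by linarith) (by linarith)

/-- Four distinct short roots in two complementary pairs. -/
lemma Z_twoA (C : Ctx D.toRootSystemData Ψ θ) {a b c d : V} (ha : a ∈ Ψ) (hb : b ∈ Ψ)
    (hc : c ∈ Ψ) (hd : d ∈ Ψ) (sa : B θ a a = 2) (sb : B θ b b = 2) (sc : B θ c c = 2)
    (sd : B θ d d = 2) (ta : B θ θ a = 2) (tb : B θ θ b = 2)
    (nab : B θ a b = 0) (nac : B θ a c = 1) (nad : B θ a d = 1) (nbc : B θ b c = 1)
    (nbd : B θ b d = 1) (hcd : c + d = θ) (hp : a - b ∈ D.pos) : Z D θ a b c d := by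
  have c1 := B_comm θ b a
  have c2 := B_comm θ c a
  have c3 := B_comm θ d a
  have c4 := B_comm θ c b
  have c5 := B_comm θ d b
  refine Z_trick C (a' := b) (e := a - b) hb hb hc hd hp ?_ (by abel) (C.root ha) ?_ (Or.inl rfl)
    (Or.inr (nr C ?_)) (Or.inr (nr C ?_))
  · rw [B_sub_right]; linarith
  · refine Z_of_norm C (w := b + b) hb hb hc hd (by rw [← hcd]; abel) ?_
    simp only [B_add_left, B_add_right]; linarith
  · simp only [B_add_left, B_add_right, B_sub_left, B_sub_right]; linarith
  · simp only [B_add_left, B_add_right, B_sub_left, B_sub_right]; linarith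

/-- Repeated complementary pair. -/
lemma Z_twoB (C : Ctx D.toRootSystemData Ψ θ) {a b : V} (ha : a ∈ Ψ) (hb : b ∈ Ψ)
    (sa : B θ a a = 2) (sb : B θ b b = 2) (ta : B θ θ a = 2) (tb : B θ θ b = 2)
    (nab : B θ a b = 0) (hab : a + b = θ) (hp : a - b ∈ D.pos) : Z D θ a b a b := by
  have c1 := B_comm θ b a
  have : Z D θ a a b b := by
    refine Z_trick C (a' := b) (e := a - b) hb ha hb hb hp ?_ (by abel) (C.root ha) ?_
      (Or.inr (nr C ?_)) (Or.inl rfl) (Or.inl rfl)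
    · rw [B_sub_right]; linarith
    · refine Z_of_norm C (w := b + b) hb ha hb hb (by rw [← hab]; abel) ?_
      simp only [B_add_left, B_add_right]; linarith
    · simp only [B_add_left, B_add_right, B_sub_left, B_sub_right]; linarith
  exact this.swap23

/-- Two complementary pairs. -/
lemma Z_two (C : Ctx D.toRootSystemData Ψ θ) {a b c d : V} (ha : a ∈ Ψ) (hb : b ∈ Ψ)
    (hc : c ∈ Ψ) (hd : d ∈ Ψ) (sa : I θ a a = 2) (sb : I θ b b = 2) (sc : I θ c c = 2)
    (sd : I θ d d = 2) (ta : I θ θ a = 2) (tb : I θ θ b = 2) (tc : I θ θ c = 2) (td : I θ θ d = 2)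
    (nab : I θ a b = 0) (ncd : I θ c d = 0) : Z D θ a b c d := by
  have ra := C.root ha
  have rb := C.root hb
  have rc := C.root hc
  have rd := C.root hd
  have rt := C.top.root
  have bsa := C.B2 ra ra sa
  have bsb := C.B2 rb rb sb
  have bsc := C.B2 rc rc sc
  have bsd := C.B2 rd rd sd
  have bta := C.B2 rt ra ta
  have btb := C.B2 rt rb tb
  have btc := C.B2 rt rc tc
  have btd := C.B2 rt rd td
  have bab := C.B0 ra rb nab
  have bcd := C.B0 rc rd ncd
  have hab := C.add_eq_top bsa bsb bta btb bab
  have hcd := C.add_eq_top bsc bsd btc btd bcd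
  have e1 := C.I_sum ra rb rt rc hab
  have e2 := C.I_sum ra rb rt rd hab
  have e3 := C.I_sum rc rd rt ra hcd
  rw [I_comm θ c a, I_comm θ d a] at e3
  have p1 := C.I_nn ha hc
  have p2 := C.I_nn ha hd
  have hr : a - b ∈ D.roots := C.diff_root rb bsb bab (by rw [hab]; exact rt)
  have same : Z D θ a b a b := by
    rcases pos_or _ hr with hp | hp
    · exact Z_twoB C ha hb bsa bsb bta btb bab hab hp
    · rw [neg_sub] at hp
      exact (Z_twoB C hb ha bsb bsa btb bta (by rw [B_comm]; exact bab)
        (by rw [add_comm]; exact hab) hp).swap12.swap34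
  have h : I θ a c = 0 ∨ I θ a c = 1 ∨ I θ a c = 2 := by omega
  rcases h with h | h | h
  · have h2 : I θ a d = 2 := by omega
    have e := C.eq_of bsa bsd (C.B2 ra rd h2)
    have e' : b = c := by
      rw [← hcd, ← e, add_comm c a] at hab
      exact add_left_cancel hab
    rw [← e, ← e']; exact same.swap34
  · have h2 : I θ a d = 1 := by omega
    have h3 : I θ b c = 1 := by omega
    have h4 : I θ b d = 1 := by omega
    rcases pos_or _ hr with hp | hp
    · exact Z_twoA C ha hb hc hd bsa bsb bsc bsd bta btb bab (C.B1 ra rc h) (C.B1 ra rd h2)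
        (C.B1 rb rc h3) (C.B1 rb rd h4) hcd hp
    · rw [neg_sub] at hp
      exact (Z_twoA C hb ha hc hd bsb bsa bsc bsd btb bta (by rw [B_comm]; exact bab)
        (C.B1 rb rc h3) (C.B1 rb rd h4) (C.B1 ra rc h) (C.B1 ra rd h2) hcd hp).swap12
  · have e := C.eq_of bsa bsc (C.B2 ra rc h)
    have e' : b = d := by
      rw [← hcd, ← e] at hab
      exact add_left_cancel hab
    rw [← e, ← e']; exact same

set_option maxHeartbeats 2000000 in
/-- All four roots have degree one. -/
lemma Z_eight (C : Ctx D.toRootSystemData Ψ θ) {a b c d : V} (ha : a ∈ Ψ) (hb : b ∈ Ψ)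
    (hc : c ∈ Ψ) (hd : d ∈ Ψ) (ta : I θ θ a = 2) (tb : I θ θ b = 2) (tc : I θ θ c = 2)
    (td : I θ θ d = 2) (hsum : a + b + c + d = θ + θ) : Z D θ a b c d := by
  have ra := C.root ha
  have rb := C.root hb
  have rc := C.root hc
  have rd := C.root hd
  have rt := C.top.root
  have bta := C.B2 rt ra ta
  have btb := C.B2 rt rb tb
  have btc := C.B2 rt rc tc
  have btd := C.B2 rt rd td
  have row : ∀ x ∈ D.roots, I θ a x + I θ b x + I θ c x + I θ d x = 2 * I θ θ x := by
    intro x hx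
    have : B θ a x + B θ b x + B θ c x + B θ d x = 2 * B θ θ x := by
      have h : B θ (a + b + c + d) x = B θ (θ + θ) x := by rw [hsum]
      simp only [B_add_left] at h
      linarith
    rw [C.I_cast ra hx, C.I_cast rb hx, C.I_cast rc hx, C.I_cast rd hx, C.I_cast rt hx] at this
    exact_mod_cast this
  have r1 := row a ra
  have r2 := row b rb
  have r3 := row c rc
  have r4 := row d rd
  rw [I_comm θ b a, I_comm θ c a, I_comm θ d a] at r1
  rw [I_comm θ c b, I_comm θ d b] at r2
  rw [I_comm θ d c] at r3
  have p1 := C.I_nn ha hb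
  have p2 := C.I_nn ha hc
  have p3 := C.I_nn ha hd
  have p4 := C.I_nn hb hc
  have p5 := C.I_nn hb hd
  have p6 := C.I_nn hc hd
  -- two long roots and a double short one
  have two : ∀ x ∈ Ψ, ∀ y ∈ Ψ, ∀ z ∈ Ψ, I θ x x = 4 → I θ y y = 4 → I θ z z = 2 →
      I θ θ x = 2 → I θ θ y = 2 → I θ θ z = 2 → I θ x y = 0 → I θ x z = 0 → I θ y z = 0 →
      Z D θ a b c d := by
    intro x hx y hy z hz h1 h2 h3 h4 h5 h6 h7 h8 h9
    have rx := C.root hx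
    have ry := C.root hy
    have rz := C.root hz
    exact (C.config2 hx hy hz (C.B4 rx rx h1) (C.B4 ry ry h2) (C.B2 rz rz h3) (C.B2 rt rx h4)
      (C.B2 rt ry h5) (C.B2 rt rz h6) (C.B0 rx ry h7) (C.B0 rx rz h8) (C.B0 ry rz h9)).elim
  -- one long root
  have one : ∀ x ∈ Ψ, ∀ y ∈ Ψ, ∀ z ∈ Ψ, ∀ w ∈ Ψ, I θ x x = 2 → I θ y y = 2 → I θ z z = 2 →
      I θ w w = 4 → I θ θ x = 2 → I θ θ y = 2 → I θ θ z = 2 → I θ θ w = 2 →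
      I θ x y = 1 → I θ x z = 1 → I θ y z = 1 → I θ x w = 0 → I θ y w = 0 → I θ z w = 0 →
      Z D θ a b c d := by
    intro x hx y hy z hz w hw h1 h2 h3 h4 h5 h6 h7 h8 h9 h10 h11 h12 h13 h14
    have rx := C.root hx
    have ry := C.root hy
    have rz := C.root hz
    have rw' := C.root hw
    exact (C.config3 hx hy hz hw (C.B2 rx rx h1) (C.B2 ry ry h2) (C.B2 rz rz h3) (C.B4 rw' rw' h4)
      (C.B2 rt rx h5) (C.B2 rt ry h6) (C.B2 rt rz h7) (C.B2 rt rw' h8)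
      (C.B1 rx ry h9) (C.B1 rx rz h10) (C.B1 ry rz h11) (C.B0 rx rw' h12) (C.B0 ry rw' h13)
      (C.B0 rz rw' h14)).elim
  have cab := I_comm θ a b
  have cac := I_comm θ a c
  have cad := I_comm θ a d
  have cbc := I_comm θ b c
  have cbd := I_comm θ b d
  have ccd := I_comm θ c d
  rcases C.I_self ra with sa | sa <;> rcases C.I_self rb with sb | sb <;>
    rcases C.I_self rc with sc | sc <;> rcases C.I_self rd with sd | sd
  · have h : I θ a b = 0 ∨ I θ a c = 0 ∨ I θ a d = 0 := by omega
    rcases h with h | h | h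
    · exact Z_two C ha hb hc hd sa sb sc sd ta tb tc td h (by omega)
    · exact (Z_two C ha hc hb hd sa sc sb sd ta tc tb td h (by omega)).swap23
    · exact (Z_two C ha hd hb hc sa sd sb sc ta td tb tc h (by omega)).swap23.swap34
  · apply one a ha b hb c hc d hd <;> omega
  · apply one a ha b hb d hd c hc <;> omega
  · apply two c hc d hd a ha <;> omega
  · apply one a ha c hc d hd b hb <;> omega
  · apply two b hb d hd a ha <;> omega
  · apply two b hb c hc a ha <;> omega
  · omega
  · apply one b hb c hc d hd a ha <;> omega
  · apply two a ha d hd b hb <;> omega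
  · apply two a ha c hc b hb <;> omega
  · omega
  · apply two a ha b hb c hc <;> omega
  · omega
  · omega
  · exact (C.config1 ha hb hc hd (C.B4 ra ra sa) (C.B4 rb rb sb) (C.B4 rd rd sd) bta btb btd
      (C.B0 ra rb (by omega)) hsum).elim

/-- Two roots of degree one, two of degree zero. -/
lemma Z_four (C : Ctx D.toRootSystemData Ψ θ) {a b c d : V} (ha : a ∈ Ψ) (hb : b ∈ Ψ)
    (hc : c ∈ Ψ) (hd : d ∈ Ψ) (sa : I θ a a = 2) (sb : I θ b b = 2) (sc : I θ c c = 2)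
    (sd : I θ d d = 2) (ta : I θ θ a = 2) (tb : I θ θ b = 2) (tc : I θ θ c = 0) (td : I θ θ d = 0)
    (nab : I θ a b = 0) (nac : I θ a c = 0) (nad : I θ a d = 0) (nbc : I θ b c = 0)
    (nbd : I θ b d = 0) (ncd : I θ c d = 0) : Z D θ a b c d := by
  have ra := C.root ha
  have rb := C.root hb
  have rc := C.root hc
  have rd := C.root hd
  have rt := C.top.root
  have bsa := C.B2 ra ra sa
  have bsb := C.B2 rb rb sb
  have bsc := C.B2 rc rc sc
  have bsd := C.B2 rd rd sd
  have bta := C.B2 rt ra ta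
  have btb := C.B2 rt rb tb
  have btc := C.B0 rt rc tc
  have btd := C.B0 rt rd td
  have bab := C.B0 ra rb nab
  have bac := C.B0 ra rc nac
  have bad := C.B0 ra rd nad
  have bbc := C.B0 rb rc nbc
  have bbd := C.B0 rb rd nbd
  have bcd := C.B0 rc rd ncd
  have hab := C.add_eq_top bsa bsb bta btb bab
  have c1 := B_comm θ b a
  have c2 := B_comm θ c a
  have c3 := B_comm θ d a
  have c4 := B_comm θ c b
  have c5 := B_comm θ d b
  have c6 := B_comm θ d c
  by_cases hcd : c + d ∈ D.roots
  swap
  · apply Z_of_weight C ha hb hc hd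
    · convert hcd using 1; rw [← hab]; abel_nf
    · have : a + b + c + d - θ = c + d := by rw [← hab]; abel
      rw [this]; exact pos_add_ne _ (C.ideal.1 hc) (C.ideal.1 hd)
  have hr : c - d ∈ D.roots := C.diff_root rd bsd bcd hcd
  rcases pos_or _ hr with hp | hp
  · have : Z D θ c d a b := by
      refine Z_trick C (a' := d) (e := c - d) hd hd ha hb hp ?_ (by abel) rc ?_ (Or.inl rfl)
        (Or.inr (nr C ?_)) (Or.inr (nr C ?_))
      · rw [B_sub_right]; linarith
      · refine Z_of_norm C (w := d + d) hd hd ha hb (by rw [← hab]; abel) ?_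
        simp only [B_add_left, B_add_right]; linarith
      · simp only [B_add_left, B_add_right, B_sub_left, B_sub_right]; linarith
      · simp only [B_add_left, B_add_right, B_sub_left, B_sub_right]; linarith
    exact this.swap23.swap12.swap34.swap23
  · rw [neg_sub] at hp
    have : Z D θ d c a b := by
      refine Z_trick C (a' := c) (e := d - c) hc hc ha hb hp ?_ (by abel) rd ?_ (Or.inl rfl)
        (Or.inr (nr C ?_)) (Or.inr (nr C ?_))
      · rw [B_sub_right]; linarith
      · refine Z_of_norm C (w := c + c) hc hc ha hb (by rw [← hab]; abel) ?_
        simp only [B_add_left, B_add_right]; linarith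
      · simp only [B_add_left, B_add_right, B_sub_left, B_sub_right]; linarith
      · simp only [B_add_left, B_add_right, B_sub_left, B_sub_right]; linarith
    exact this.swap12.swap23.swap12.swap34.swap23

lemma Z_k3d (C : Ctx D.toRootSystemData Ψ θ) {a b d : V} (ha : a ∈ Ψ) (hb : b ∈ Ψ)
    (hd : d ∈ Ψ) (sa : I θ a a = 2) (sb : I θ b b = 2)
    (sd : I θ d d = 2) (ta : I θ θ a = 2) (tb : I θ θ b = 2) (td : I θ θ d = 0)
    (nab : I θ a b = 0) (nad : I θ a d = 0) (nbd : I θ b d = 0) : Z D θ a a b d := by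
  have ra := C.root ha
  have rb := C.root hb
  have rd := C.root hd
  have rt := C.top.root
  have bsa := C.B2 ra ra sa
  have bsb := C.B2 rb rb sb
  have bsd := C.B2 rd rd sd
  have bta := C.B2 rt ra ta
  have btb := C.B2 rt rb tb
  have btd := C.B0 rt rd td
  have bab := C.B0 ra rb nab
  have bad := C.B0 ra rd nad
  have bbd := C.B0 rb rd nbd
  have hab := C.add_eq_top bsa bsb bta btb bab
  have c1 := B_comm θ b a
  have c3 := B_comm θ d a
  have c5 := B_comm θ d b
  have hr : a - b ∈ D.roots := C.diff_root rb bsb bab (by rw [hab]; exact rt)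
  rcases pos_or _ hr with hp | hp
  · have h0 : Z D θ b b b d := by
      refine Z_of_norm C (w := b + b + d - a) hb hb hb hd (by rw [← hab]; abel) ?_
      simp only [B_add_left, B_add_right, B_sub_left, B_sub_right]; linarith
    have h1 : Z D θ a b b d := by
      refine Z_trick C (a' := b) (e := a - b) hb hb hb hd hp ?_ (by abel) ra h0 (Or.inl rfl)
        (Or.inl rfl) (Or.inr (nr C ?_))
      · rw [B_sub_right]; linarith
      · simp only [B_add_left, B_add_right, B_sub_left, B_sub_right]; linarith
    refine Z_trick C (a' := b) (e := a - b) hb ha hb hd hp ?_ (by abel) ra h1.swap12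
      (Or.inr (nr C ?_)) (Or.inl rfl) (Or.inr (nr C ?_))
    · rw [B_sub_right]; linarith
    · simp only [B_add_left, B_add_right, B_sub_left, B_sub_right]; linarith
    · simp only [B_add_left, B_add_right, B_sub_left, B_sub_right]; linarith
  · rw [neg_sub] at hp
    have h0 : Z D θ a a a d := by
      refine Z_of_norm C (w := a + a + d - b) ha ha ha hd (by rw [← hab]; abel) ?_
      simp only [B_add_left, B_add_right, B_sub_left, B_sub_right]; linarith
    have h1 : Z D θ b a a d := by
      refine Z_trick C (a' := a) (e := b - a) ha ha ha hd hp ?_ (by abel) rb h0 (Or.inl rfl)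
        (Or.inl rfl) (Or.inr (nr C ?_))
      · rw [B_sub_right]; linarith
      · simp only [B_add_left, B_add_right, B_sub_left, B_sub_right]; linarith
    exact h1.swap12.swap23

lemma Z_six' (C : Ctx D.toRootSystemData Ψ θ) {a b c d : V} (ha : a ∈ Ψ) (hb : b ∈ Ψ)
    (hc : c ∈ Ψ) (hd : d ∈ Ψ) (ta : I θ θ a = 2) (tb : I θ θ b = 2) (tc : I θ θ c = 2)
    (td : I θ θ d = 0) (hr : c + d ∈ D.roots)
    (hQ : I θ a a + I θ b b + I θ c c + I θ d d + 2 * (I θ a b + I θ a c + I θ a d + I θ b c +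
      I θ b d + I θ c d) ≤ 12) : Z D θ a b c d := by
  have ra := C.root ha
  have rb := C.root hb
  have rc := C.root hc
  have rd := C.root hd
  have rt := C.top.root
  obtain ⟨bsc, bsd, bcd, bz⟩ := C.add_root hc hd hr
  have sc : I θ c c = 2 := by unfold I; rw [bsc]; norm_num
  have sd : I θ d d = 2 := by unfold I; rw [bsd]; norm_num
  have ncd : I θ c d = 0 := by unfold I; rw [bcd]; norm_num
  have sz : I θ (c + d) (c + d) = 4 := by unfold I; rw [bz]; norm_num
  have par : ∀ x ∈ D.roots, (I θ c x + I θ d x) % 2 = 0 := by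
    intro x hx
    rw [C.I_sum rc rd hr hx rfl]
    have := C.I_even hx hr sz
    rw [I_comm] at this; omega
  have pa := par a ra
  have pb := par b rb
  rw [I_comm θ c, I_comm θ d] at pa pb
  have p1 := C.pair ha hb
  have p2 := C.pair ha hc
  have p3 := C.pair ha hd
  have p4 := C.pair hb hc
  have p5 := C.pair hb hd
  have bta := C.B2 rt ra ta
  have btb := C.B2 rt rb tb
  have btc := C.B2 rt rc tc
  have cab := I_comm θ a b
  have cac := I_comm θ a c
  have cad := I_comm θ a d
  have cbc := I_comm θ b c
  have cbd := I_comm θ b d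
  have ccd := I_comm θ c d
  rcases C.I_self ra with sa | sa <;> rcases C.I_self rb with sb | sb
  · have bsa := C.B2 ra ra sa
    have bsb := C.B2 rb rb sb
    by_cases h : I θ a c = 0
    · have e := C.add_eq_top bsa bsc bta btc (C.B0 ra rc h)
      have e1 := C.I_sum ra rc rt rd e
      have e2 := C.I_sum ra rc rt rb e
      have nad : I θ a d = 0 := by omega
      have h2 : I θ b c = 0 ∨ I θ b c = 2 := by omega
      rcases h2 with h2 | h2
      · have hh := C.eq_of bsa bsb (C.B2 ra rb (by omega))
        rw [← hh]
        exact Z_k3d C ha hc hd sa sc sd ta tc td h nad ncd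
      · have hh := C.eq_of bsb bsc (C.B2 rb rc h2)
        rw [hh]
        exact (Z_k3d C hc ha hd sc sa sd tc ta td (by omega) ncd nad).swap23.swap12
    · by_cases h' : I θ b c = 0
      · have e := C.add_eq_top bsb bsc btb btc (C.B0 rb rc h')
        have e1 := C.I_sum rb rc rt rd e
        have e2 := C.I_sum rb rc rt ra e
        have hh := C.eq_of bsa bsc (C.B2 ra rc (by omega))
        rw [hh]
        exact (Z_k3d C hc hb hd sc sb sd tc tb td (by omega) ncd (by omega)).swap23
      · omega
  · have e := C.add_eq_top (C.B2 ra ra sa) bsc bta btc (C.B0 ra rc (by omega))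
    have e1 := C.I_sum ra rc rt rb e
    omega
  · have e := C.add_eq_top (C.B2 rb rb sb) bsc btb btc (C.B0 rb rc (by omega))
    have e1 := C.I_sum rb rc rt ra e
    omega
  · exact (C.config2 ha hb hc (C.B4 ra ra sa) (C.B4 rb rb sb) bsc bta btb btc
      (C.B0 ra rb (by omega)) (C.B0 ra rc (by omega)) (C.B0 rb rc (by omega))).elim

/-- Three roots of degree one and one of degree zero. -/
lemma Z_six (C : Ctx D.toRootSystemData Ψ θ) {a b c d : V} (ha : a ∈ Ψ) (hb : b ∈ Ψ)
    (hc : c ∈ Ψ) (hd : d ∈ Ψ) (ta : I θ θ a = 2) (tb : I θ θ b = 2) (tc : I θ θ c = 2)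
    (td : I θ θ d = 0)
    (hQ : I θ a a + I θ b b + I θ c c + I θ d d + 2 * (I θ a b + I θ a c + I θ a d + I θ b c +
      I θ b d + I θ c d) ≤ 12) : Z D θ a b c d := by
  have cab := I_comm θ a b
  have cac := I_comm θ a c
  have cbc := I_comm θ b c
  by_cases h1 : c + d ∈ D.roots
  · exact Z_six' C ha hb hc hd ta tb tc td h1 hQ
  by_cases h2 : b + d ∈ D.roots
  · exact (Z_six' C ha hc hb hd ta tc tb td h2 (by omega)).swap23
  by_cases h3 : a + d ∈ D.roots
  · exact (Z_six' C hb hc ha hd tb tc ta td h3 (by omega)).swap23.swap12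
  exact Z_of_comm C ha hb hc hd (C.B0 C.top.root (C.root hd) td) h3 h2 h1

set_option maxHeartbeats 1000000 in
/-- All symmetrized words of length four kill the lowest root space. -/
theorem Z_all (C : Ctx D.toRootSystemData Ψ θ) {a b c d : V} (ha : a ∈ Ψ) (hb : b ∈ Ψ)
    (hc : c ∈ Ψ) (hd : d ∈ Ψ) : Z D θ a b c d := by
  have ra := C.root ha
  have rb := C.root hb
  have rc := C.root hc
  have rd := C.root hd
  have rt := C.top.root
  have expand : ∀ t : ℝ, B θ (a + b + c + d - t • θ) (a + b + c + d - t • θ) =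
      ((I θ a a + I θ b b + I θ c c + I θ d d + 2 * (I θ a b + I θ a c + I θ a d + I θ b c +
      I θ b d + I θ c d) : ℤ) : ℝ) - 2 * t * ((I θ θ a + I θ θ b + I θ θ c + I θ θ d : ℤ) : ℝ)
      + 4 * t ^ 2 := by
    intro t
    have hs : ∀ u, B θ (t • θ) u = t * B θ θ u := fun u => by
      simp only [B, real_inner_smul_left]; ring
    have hs' : ∀ u, B θ u (t • θ) = t * B θ θ u := fun u => by rw [B_comm, hs]
    push_cast
    rw [← C.I_cast ra ra, ← C.I_cast rb rb, ← C.I_cast rc rc, ← C.I_cast rd rd, ← C.I_cast ra rb,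
      ← C.I_cast ra rc, ← C.I_cast ra rd, ← C.I_cast rb rc, ← C.I_cast rb rd, ← C.I_cast rc rd,
      ← C.I_cast rt ra, ← C.I_cast rt rb, ← C.I_cast rt rc, ← C.I_cast rt rd]
    simp only [B_sub_left, B_sub_right, B_add_left, B_add_right, hs, hs']
    rw [C.B_top, B_comm θ b a, B_comm θ c a, B_comm θ d a, B_comm θ c b, B_comm θ d b,
      B_comm θ d c]
    ring
  by_cases hw : 4 < B θ (a + b + c + d - θ) (a + b + c + d - θ)
  · exact Z_of_norm C ha hb hc hd rfl hw
  have hQ : I θ a a + I θ b b + I θ c c + I θ d d + 2 * (I θ a b + I θ a c + I θ a d + I θ b c +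
      I θ b d + I θ c d) ≤ 2 * (I θ θ a + I θ θ b + I θ θ c + I θ θ d) := by
    have e := expand 1
    rw [one_smul] at e
    rw [e] at hw
    have : ((I θ a a + I θ b b + I θ c c + I θ d d + 2 * (I θ a b + I θ a c + I θ a d + I θ b c +
      I θ b d + I θ c d) : ℤ) : ℝ) ≤ ((2 * (I θ θ a + I θ θ b + I θ θ c + I θ θ d) : ℤ) : ℝ) := by
      push_cast at hw ⊢; linarith
    exact_mod_cast this
  have sa := C.I_self ra
  have sb := C.I_self rb
  have sc := C.I_self rc
  have sd := C.I_self rd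
  have p1 := C.I_nn ha hb
  have p2 := C.I_nn ha hc
  have p3 := C.I_nn ha hd
  have p4 := C.I_nn hb hc
  have p5 := C.I_nn hb hd
  have p6 := C.I_nn hc hd
  have ht : ∀ x ∈ Ψ, I θ θ x = 0 ∨ I θ θ x = 2 ∨ x = θ := by
    intro x hx
    have h0 := C.B_top_nn (C.ideal.1 hx)
    rw [C.I_cast rt (C.root hx)] at h0
    have h0' : 0 ≤ I θ θ x := by exact_mod_cast h0
    have h1 := C.I_even (C.root hx) rt C.I_top
    rw [I_comm] at h1
    by_cases h : x = θ
    · exact Or.inr (Or.inr h)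
    have h2 := C.I_ne rt (C.root hx) (fun e => h e.symm)
    have h3 := C.I_self (C.root hx)
    have h4 := C.I_top
    omega
  have cab := I_comm θ a b
  have cac := I_comm θ a c
  have cad := I_comm θ a d
  have cbc := I_comm θ b c
  have cbd := I_comm θ b d
  have ccd := I_comm θ c d
  have t4 := C.I_top
  have nt : ∀ x ∈ Ψ, 0 ≤ I θ θ x := fun x hx => by
    rcases ht x hx with h | h | h
    · omega
    · omega
    · rw [h]; omega
  have na := nt a ha
  have nb := nt b hb
  have nc := nt c hc
  have nd := nt d hd
  rcases ht a ha with ta | ta | rfl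
  rotate_left 2
  · omega
  all_goals rcases ht b hb with tb | tb | rfl
  rotate_left 2
  · omega
  rotate_left 2
  · omega
  all_goals rcases ht c hc with tc | tc | rfl
  all_goals try omega
  all_goals rcases ht d hd with td | td | rfl
  all_goals try omega
  · exact (Z_four C hc hd ha hb (by omega) (by omega) (by omega) (by omega) tc td ta tb
      (by omega) (by omega) (by omega) (by omega) (by omega) (by omega)).swap23.swap12.swap34.swap23
  · exact (Z_four C hb hd ha hc (by omega) (by omega) (by omega) (by omega) tb td ta tc
      (by omega) (by omega) (by omega) (by omega) (by omega) (by omega)).swap23.swap12.swap34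
  · exact (Z_four C hb hc ha hd (by omega) (by omega) (by omega) (by omega) tb tc ta td
      (by omega) (by omega) (by omega) (by omega) (by omega) (by omega)).swap23.swap12
  · exact (Z_six C hb hc hd ha tb tc td ta (by omega)).swap34.swap23.swap12
  · exact (Z_four C ha hd hb hc (by omega) (by omega) (by omega) (by omega) ta td tb tc
      (by omega) (by omega) (by omega) (by omega) (by omega) (by omega)).swap23.swap34
  · exact (Z_four C ha hc hb hd (by omega) (by omega) (by omega) (by omega) ta tc tb td
      (by omega) (by omega) (by omega) (by omega) (by omega) (by omega)).swap23
  · exact (Z_six C ha hc hd hb ta tc td tb (by omega)).swap34.swap23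
  · exact (Z_four C ha hb hc hd (by omega) (by omega) (by omega) (by omega) ta tb tc td
      (by omega) (by omega) (by omega) (by omega) (by omega) (by omega))
  · exact (Z_six C ha hb hd hc ta tb td tc (by omega)).swap34
  · exact (Z_six C ha hb hc hd ta tb tc td (by omega))
  · refine Z_eight C ha hb hc hd ta tb tc td ?_
    have e := expand 2
    have h0 : a + b + c + d - (2 : ℝ) • θ = 0 := by
      apply C.eq_zero
      rw [e]
      have : ((I θ a a + I θ b b + I θ c c + I θ d d + 2 * (I θ a b + I θ a c + I θ a d + I θ b c +
        I θ b d + I θ c d) : ℤ) : ℝ) ≤ ((2 * (I θ θ a + I θ θ b + I θ θ c + I θ θ d) : ℤ) : ℝ) := by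
        exact_mod_cast hQ
      rw [ta, tb, tc, td] at this ⊢
      push_cast at this ⊢
      linarith
    rw [two_smul, sub_eq_zero] at h0
    exact h0

end CasesZ

end SphAux

namespace SphAux

section Back

variable {L : Type*} [LieRing L] [LieAlgebra ℂ L] (D : LieRootData V L) (Ψ : Set V)

/-- Root vectors with root in `Ψ`. -/
def RV (x : L) : Prop := ∃ a ∈ Ψ, x ∈ D.rs a

/-- The vectors killed by all symmetrized words of length four. -/
def K : Submodule ℂ L where
  carrier := {y | ∀ x1 x2 x3 x4, RV D Ψ x1 → RV D Ψ x2 → RV D Ψ x3 → RV D Ψ x4 →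
    S4 (LieAlgebra.ad ℂ L x1) (LieAlgebra.ad ℂ L x2) (LieAlgebra.ad ℂ L x3)
      (LieAlgebra.ad ℂ L x4) y = 0}
  add_mem' := by
    intro y z hy hz x1 x2 x3 x4 h1 h2 h3 h4
    rw [map_add, hy x1 x2 x3 x4 h1 h2 h3 h4, hz x1 x2 x3 x4 h1 h2 h3 h4, add_zero]
  zero_mem' := by
    intro x1 x2 x3 x4 _ _ _ _
    rw [map_zero]
  smul_mem' := by
    intro c y hy x1 x2 x3 x4 h1 h2 h3 h4
    rw [map_smul, hy x1 x2 x3 x4 h1 h2 h3 h4, smul_zero]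

variable {D Ψ}

lemma mem_K {y : L} : y ∈ K D Ψ ↔ ∀ x1 x2 x3 x4, RV D Ψ x1 → RV D Ψ x2 → RV D Ψ x3 → RV D Ψ x4 →
    S4 (LieAlgebra.ad ℂ L x1) (LieAlgebra.ad ℂ L x2) (LieAlgebra.ad ℂ L x3)
      (LieAlgebra.ad ℂ L x4) y = 0 := Iff.rfl

/-- Bracketing with positive root vectors preserves `RV`. -/
lemma RV_lie (hΨ : D.CombIdeal Ψ) {e : V} (he : e ∈ D.pos) {E x : L} (hE : E ∈ D.rs e)
    (hx : RV D Ψ x) : RV D Ψ ⁅E, x⁆ := by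
  obtain ⟨a, ha, hx⟩ := hx
  have ra := D.pos_subset (hΨ.1 ha)
  have re := D.pos_subset he
  by_cases h : e + a ∈ D.roots
  · refine ⟨e + a, ?_, D.bracket_mem e re a ra h E hE x hx⟩
    rw [add_comm] at h ⊢
    exact hΨ.2 a ha e he (D.pos_add a (hΨ.1 ha) e he h)
  · refine ⟨a, ha, ?_⟩
    rw [D.bracket_eq_zero e re a ra h (pos_add_ne _ he (hΨ.1 ha)) E hE x hx]
    exact Submodule.zero_mem _

lemma K_lie (hΨ : D.CombIdeal Ψ) {e : V} (he : e ∈ D.pos) {E y : L} (hE : E ∈ D.rs e)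
    (hy : y ∈ K D Ψ) : ⁅E, y⁆ ∈ K D Ψ := by
  intro x1 x2 x3 x4 h1 h2 h3 h4
  have hl := S4_lie (LieAlgebra.ad ℂ L E) (LieAlgebra.ad ℂ L x1) (LieAlgebra.ad ℂ L x2)
    (LieAlgebra.ad ℂ L x3) (LieAlgebra.ad ℂ L x4)
  simp only [ad_lie'] at hl
  have hl2 := LinearMap.congr_fun hl y
  simp only [LinearMap.add_apply] at hl2
  rw [hy _ _ _ _ (RV_lie hΨ he hE h1) h2 h3 h4, hy _ _ _ _ h1 (RV_lie hΨ he hE h2) h3 h4,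
    hy _ _ _ _ h1 h2 (RV_lie hΨ he hE h3) h4, hy _ _ _ _ h1 h2 h3 (RV_lie hΨ he hE h4),
    LinearMap.sub_apply, Module.End.mul_apply, Module.End.mul_apply, hy _ _ _ _ h1 h2 h3 h4,
    map_zero, LieAlgebra.ad_apply] at hl2
  simpa using hl2

variable {θ : V}

lemma RV_triple (C : Ctx D.toRootSystemData Ψ θ) {u x2 x3 : L} (hu : RV D Ψ u) (h2 : RV D Ψ x2)
    (h3 : RV D Ψ x3) : ⁅x3, ⁅x2, u⁆⁆ = 0 := by
  obtain ⟨e, he, hu⟩ := hu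
  obtain ⟨b, hb, h2⟩ := h2
  obtain ⟨c, hc, h3⟩ := h3
  by_cases h : b + e ∈ D.roots
  · have hz := D.bracket_mem b (C.root hb) e (C.root he) h x2 h2 u hu
    exact D.bracket_eq_zero c (C.root hc) _ h (C.class_two hb he hc h)
      (pos_add_ne _ (C.ideal.1 hc) (D.pos_add b (C.ideal.1 hb) e (C.ideal.1 he) h)) x3 h3 _ hz
  · rw [D.bracket_eq_zero b (C.root hb) e (C.root he) h
      (pos_add_ne _ (C.ideal.1 hb) (C.ideal.1 he)) x2 h2 u hu, lie_zero]

lemma mem_K_of (C : Ctx D.toRootSystemData Ψ θ) {y : L} (h : ∀ x, RV D Ψ x → RV D Ψ ⁅x, y⁆) :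
    y ∈ K D Ψ := by
  intro x1 x2 x3 x4 h1 h2 h3 h4
  have key : ∀ z1 z2 z3, RV D Ψ z1 → RV D Ψ z2 → RV D Ψ z3 → ⁅z1, ⁅z2, ⁅z3, y⁆⁆⁆ = 0 :=
    fun z1 z2 z3 g1 g2 g3 => RV_triple C (h z3 g3) g2 g1
  simp only [S4, S3, S2, mul_add, LinearMap.add_apply, Module.End.mul_apply, LieAlgebra.ad_apply]
  simp only [key, h1, h2, h3, h4, lie_zero, add_zero]

theorem K_top (hirr : D.IsIrreducible) (hG : D.NotG2) (hΨ : D.CombIdeal Ψ)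
    (nn : ∀ a ∈ Ψ, ∀ b ∈ Ψ, 0 ≤ ⟪a, b⟫) : K D Ψ = ⊤ := by
  have mkC : ∀ θ, IsTop D.toRootSystemData θ → Ctx D.toRootSystemData Ψ θ := fun θ hθ =>
    ⟨hG, hθ, fun a ha => lengths hirr hG hθ ha, hΨ, nn⟩
  obtain ⟨θ₀, hθ₀⟩ := exists_top D.toRootSystemData hirr
  have C₀ := mkC θ₀ hθ₀
  rw [eq_top_iff, ← D.sup_eq_top]
  have hpos : ∀ γ ∈ D.pos, D.rs γ ≤ K D Ψ := by
    intro γ hγ y hy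
    apply mem_K_of C₀
    intro x hx
    have := RV_lie hΨ hγ hy hx
    obtain ⟨a, ha, h⟩ := this
    refine ⟨a, ha, ?_⟩
    rw [← lie_skew]; exact Submodule.neg_mem _ h
  have hall : ∀ γ ∈ D.roots, D.rs γ ≤ K D Ψ := by
    by_contra hc
    push Not at hc
    obtain ⟨γ₁, hγ₁, hb₁⟩ := hc
    obtain ⟨γ, ⟨hγ, hbad⟩, hmin, -⟩ := exists_min D.toRootSystemData
      {γ | γ ∈ D.roots ∧ ¬ D.rs γ ≤ K D Ψ} (fun _ h => h.1) ⟨γ₁, hγ₁, hb₁⟩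
    have hn : -γ ∈ D.pos := (pos_or _ hγ).resolve_left (fun h => hbad (hpos γ h))
    have htop : IsTop D.toRootSystemData (-γ) := by
      refine ⟨hn, fun e he hr => hbad ?_⟩
      have hr' := neg_mem _ hr
      have e1 : -(-γ + e) = γ - e := by abel
      rw [e1] at hr'
      have hle : D.rs (γ - e) ≤ K D Ψ := by
        by_contra h; exact hmin e he ⟨hr', h⟩
      have re := D.pos_subset he
      obtain ⟨E, hE, hE0, -⟩ := rs_line D re
      obtain ⟨y, hy, hy0, -⟩ := rs_line D hr'
      have e2 : e + (γ - e) = γ := by abel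
      have m1 := D.bracket_mem e re _ hr' (by rw [e2]; exact hγ) E hE y hy
      have m2 := D.bracket_ne_zero e re _ hr' (by rw [e2]; exact hγ) E hE hE0 y hy hy0
      rw [e2] at m1
      intro z hz
      obtain ⟨c, rfl⟩ := rs_line' D hγ m1 m2 hz
      exact Submodule.smul_mem _ _ (K_lie hΨ he hE (hle hy))
    have C := mkC _ htop
    apply hbad
    rintro y hy x1 x2 x3 x4 ⟨a, ha, h1⟩ ⟨b, hb, h2⟩ ⟨c, hc, h3⟩ ⟨d, hd, h4⟩
    exact Z_all C ha hb hc hd x1 h1 x2 h2 x3 h3 x4 h4 y (by rw [neg_neg]; exact hy)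
  refine sup_le ?_ (iSup₂_le hall)
  intro h hh
  apply mem_K_of C₀
  rintro x ⟨a, ha, hx⟩
  refine ⟨a, ha, ?_⟩
  obtain ⟨c, hc⟩ := D.weight_vec a (C₀.root ha) h hh x hx
  rw [← lie_skew, hc]
  exact Submodule.neg_mem _ (Submodule.smul_mem _ _ hx)

/-- Polarization: linear extension in one argument. -/
lemma ext_slot {p : L → Prop} (h0 : p 0) (hadd : ∀ x y, p x → p y → p (x + y))
    (hrv : ∀ x, RV D Ψ x → p x) : ∀ x ∈ D.aSubspace Ψ, p x := by
  intro x hx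
  unfold LieRootData.aSubspace at hx
  refine Submodule.iSup_induction (fun a => ⨆ (_ : a ∈ Ψ), D.rs a) (motive := p) hx ?_ h0 hadd
  intro a y hy
  by_cases ha : a ∈ Ψ
  · exact hrv y ⟨a, ha, by simpa [ha] using hy⟩
  · have : y = 0 := by simpa [ha] using hy
    rw [this]; exact h0

theorem spherical_of (hirr : D.IsIrreducible) (hG : D.NotG2) (hΨ : D.CombIdeal Ψ)
    (nn : ∀ a ∈ Ψ, ∀ b ∈ Ψ, 0 ≤ ⟪a, b⟫) : IsSphericalSubspace (D.aSubspace Ψ) := by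
  have hK := K_top hirr hG hΨ nn
  have h0 : ∀ x1 x2 x3 x4, RV D Ψ x1 → RV D Ψ x2 → RV D Ψ x3 → RV D Ψ x4 →
      S4 (LieAlgebra.ad ℂ L x1) (LieAlgebra.ad ℂ L x2) (LieAlgebra.ad ℂ L x3)
      (LieAlgebra.ad ℂ L x4) = 0 := by
    intro x1 x2 x3 x4 h1 h2 h3 h4
    refine LinearMap.ext fun y => ?_
    have hy : y ∈ K D Ψ := by rw [hK]; exact Submodule.mem_top
    exact hy x1 x2 x3 x4 h1 h2 h3 h4
  have h1 : ∀ x1 ∈ D.aSubspace Ψ, ∀ x2 x3 x4, RV D Ψ x2 → RV D Ψ x3 → RV D Ψ x4 →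
      S4 (LieAlgebra.ad ℂ L x1) (LieAlgebra.ad ℂ L x2) (LieAlgebra.ad ℂ L x3)
      (LieAlgebra.ad ℂ L x4) = 0 := by
    apply ext_slot
    · intro x2 x3 x4 _ _ _; rw [map_zero, S4_zero]
    · intro x y hx hy x2 x3 x4 g2 g3 g4
      rw [map_add, S4_add, hx x2 x3 x4 g2 g3 g4, hy x2 x3 x4 g2 g3 g4, add_zero]
    · intro x hx x2 x3 x4 g2 g3 g4; exact h0 x x2 x3 x4 hx g2 g3 g4
  have h2 : ∀ x2 ∈ D.aSubspace Ψ, ∀ x1 ∈ D.aSubspace Ψ, ∀ x3 x4, RV D Ψ x3 → RV D Ψ x4 →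
      S4 (LieAlgebra.ad ℂ L x2) (LieAlgebra.ad ℂ L x1) (LieAlgebra.ad ℂ L x3)
      (LieAlgebra.ad ℂ L x4) = 0 := by
    apply ext_slot
    · intro x1 _ x3 x4 _ _; rw [map_zero, S4_zero]
    · intro x y hx hy x1 g1 x3 x4 g3 g4
      rw [map_add, S4_add, hx x1 g1 x3 x4 g3 g4, hy x1 g1 x3 x4 g3 g4, add_zero]
    · intro x hx x1 g1 x3 x4 g3 g4
      rw [S4_swap12]; exact h1 x1 g1 x x3 x4 hx g3 g4
  have h3 : ∀ x3 ∈ D.aSubspace Ψ, ∀ x1 ∈ D.aSubspace Ψ, ∀ x2 ∈ D.aSubspace Ψ, ∀ x4, RV D Ψ x4 →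
      S4 (LieAlgebra.ad ℂ L x3) (LieAlgebra.ad ℂ L x1) (LieAlgebra.ad ℂ L x2)
      (LieAlgebra.ad ℂ L x4) = 0 := by
    apply ext_slot
    · intro x1 _ x2 _ x4 _; rw [map_zero, S4_zero]
    · intro x y hx hy x1 g1 x2 g2 x4 g4
      rw [map_add, S4_add, hx x1 g1 x2 g2 x4 g4, hy x1 g1 x2 g2 x4 g4, add_zero]
    · intro x hx x1 g1 x2 g2 x4 g4
      rw [S4_swap13]; exact h2 x2 g2 x1 g1 x x4 hx g4
  have h4 : ∀ x4 ∈ D.aSubspace Ψ, ∀ x1 ∈ D.aSubspace Ψ, ∀ x2 ∈ D.aSubspace Ψ,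
      ∀ x3 ∈ D.aSubspace Ψ,
      S4 (LieAlgebra.ad ℂ L x4) (LieAlgebra.ad ℂ L x1) (LieAlgebra.ad ℂ L x2)
      (LieAlgebra.ad ℂ L x3) = 0 := by
    apply ext_slot
    · intro x1 _ x2 _ x3 _; rw [map_zero, S4_zero]
    · intro x y hx hy x1 g1 x2 g2 x3 g3
      rw [map_add, S4_add, hx x1 g1 x2 g2 x3 g3, hy x1 g1 x2 g2 x3 g3, add_zero]
    · intro x hx x1 g1 x2 g2 x3 g3
      rw [S4_swap14]; exact h3 x3 g3 x1 g1 x2 g2 x hx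
  intro x hx
  have := h4 x hx x hx x hx x hx
  rw [S4_self] at this
  have h24 : (24 : Module.End ℂ L) * (LieAlgebra.ad ℂ L x) ^ 4 =
      (24 : ℂ) • (LieAlgebra.ad ℂ L x) ^ 4 := by
    rw [← map_ofNat (algebraMap ℂ (Module.End ℂ L)) 24, Algebra.smul_def]
  rw [h24] at this
  exact (smul_eq_zero.1 this).resolve_left (by norm_num)

end Back

end SphAux

namespace SphAux

section Fwd

variable {L : Type*} [LieRing L] [LieAlgebra ℂ L]

lemma ad4 (x y : L) : ((LieAlgebra.ad ℂ L x) ^ 4) y = ⁅x, ⁅x, ⁅x, ⁅x, y⁆⁆⁆⁆ := by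
  simp only [pow_succ, pow_zero, one_mul, Module.End.mul_apply, LieAlgebra.ad_apply]

/-- Computation in a subalgebra of type `A₂`. -/
lemma A2_abs {a b y z y0 y1 h1 h2 : L} {t t' s s' : ℂ} (hz : ⁅a, b⁆ = z) (hy0 : ⁅a, y⁆ = y0)
    (hy1 : ⁅b, y⁆ = y1) (e0 : ⁅a, y0⁆ = 0) (e1 : ⁅b, y1⁆ = 0) (hh1 : ⁅b, y0⁆ = h1)
    (hh2 : ⁅a, y1⁆ = h2) (az : ⁅a, z⁆ = 0) (bz : ⁅b, z⁆ = 0) (w1 : ⁅h1, a⁆ = t • a)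
    (w2 : ⁅h1, b⁆ = t' • b) (w3 : ⁅h2, a⁆ = s • a) (w4 : ⁅h2, b⁆ = s' • b)
    (a0 : a ≠ 0) (z0 : z ≠ 0) (ne : ⁅y0, z⁆ ≠ 0)
    (h4 : ⁅a + b, ⁅a + b, ⁅a + b, ⁅a + b, y⁆⁆⁆⁆ = 0) : False := by
  have ba : ⁅b, a⁆ = -z := by rw [← lie_skew, hz]
  have sk : ∀ {x x' r : L}, ⁅x, x'⁆ = r → ⁅x', x⁆ = -r := fun {x x' r} h => by rw [← lie_skew, h]
  have k1 : ⁅y0, z⁆ = t • a := by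
    have := leibniz_lie a b y0
    rw [hh1, hz, e0, lie_zero, add_zero, sk w1] at this
    rw [sk this.symm, neg_neg]
  have t0 : t ≠ 0 := by
    rintro rfl; rw [zero_smul] at k1; exact ne k1
  have k2 : t' = -2 * t := by
    have h := leibniz_lie y0 b z
    have hz2 : ⁅h1, z⁆ = (t + t') • z := by
      have := leibniz_lie h1 a b
      rw [hz, w1, w2, smul_lie, lie_smul, hz, ← add_smul] at this
      exact this
    rw [bz, lie_zero, sk hh1, neg_lie, hz2, k1, lie_smul, ba] at h
    have h' : (-(t + t') - t) • z = 0 := by rw [h]; module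
    have := (smul_eq_zero.1 h').resolve_right z0
    linear_combination -this
  have k3 : ⁅z, y⁆ = h2 - h1 := by
    have := leibniz_lie a b y
    rw [hz, hy1, hy0, hh1, hh2] at this
    rw [this]; abel
  have k4 : s = 2 * t := by
    have h := leibniz_lie a y z
    rw [hy0, k1, az, lie_zero, add_zero, sk k3, lie_neg, lie_sub, sk w1, sk w3] at h
    have h' : (s - t - t) • a = 0 := by
      have : (s - t - t) • a = -(-(s • a) - -(t • a)) - t • a := by module
      rw [this, h, sub_self]
    have := (smul_eq_zero.1 h').resolve_right a0
    linear_combination this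
  have k5 : s' = -t := by
    have h := leibniz_lie y1 a z
    have hz2 : ⁅h2, z⁆ = (s + s') • z := by
      have := leibniz_lie h2 a b
      rw [hz, w3, w4, smul_lie, lie_smul, hz, ← add_smul] at this
      exact this
    have h5 : ⁅y1, z⁆ = -(s' • b) := by
      have := leibniz_lie b a y1
      rw [hh2, ba, neg_lie, e1, lie_zero, add_zero, sk w4, neg_inj] at this
      rw [sk this.symm]
    rw [az, lie_zero, sk hh2, neg_lie, hz2, h5, lie_neg, lie_smul, hz] at h
    have h' : (-(s + s') - s') • z = 0 := by rw [h]; module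
    have := (smul_eq_zero.1 h').resolve_right z0
    linear_combination (-1 / 2) * this - (1 / 2) * k4
  have n1 : ⁅a + b, y⁆ = y0 + y1 := by rw [add_lie, hy0, hy1]
  have n2 : ⁅a + b, y0 + y1⁆ = h1 + h2 := by
    rw [add_lie, lie_add, lie_add, e0, e1, hh1, hh2]; abel
  have n3 : ⁅a + b, h1 + h2⁆ = (-3 * t) • a + (3 * t) • b := by
    rw [add_lie, lie_add, lie_add, sk w1, sk w2, sk w3, sk w4, k2, k4, k5]; module
  have n4 : ⁅a + b, (-3 * t) • a + (3 * t) • b⁆ = (6 * t) • z := by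
    rw [add_lie, lie_add, lie_add, lie_smul, lie_smul, lie_smul, lie_smul, lie_self, lie_self, hz,
      ba]
    module
  rw [n1, n2, n3, n4] at h4
  have := (smul_eq_zero.1 h4).resolve_right z0
  exact t0 (by linear_combination this / 6)

/-- Computation in a subalgebra of type `B₂`. -/
lemma B2_abs {a b y u v w h h' z : L} {p p' q q' g c r : ℂ} (hz : ⁅a, b⁆ = z) (ay : ⁅a, y⁆ = 0)
    (hu : ⁅b, y⁆ = u) (hv : ⁅a, u⁆ = v) (hw : ⁅b, u⁆ = w) (av : ⁅a, v⁆ = 0) (bw : ⁅b, w⁆ = 0)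
    (hh : ⁅a, w⁆ = h) (hh' : ⁅b, v⁆ = h') (w1 : ⁅h, b⁆ = p • b) (w2 : ⁅h', b⁆ = p' • b)
    (w3 : ⁅h, a⁆ = q • a) (w4 : ⁅h', a⁆ = q' • a) (w5 : ⁅⁅z, u⁆, z⁆ = g • z)
    (w6 : ⁅⁅z, u⁆, w⁆ = c • w) (uw : ⁅u, w⁆ = 0) (zzz : ⁅z, ⁅z, ⁅z, w⁆⁆⁆ = 0)
    (zz : ⁅z, ⁅z, w⁆⁆ ≠ 0) (zw : ⁅z, w⁆ ≠ 0) (hb : b = r • ⁅z, w⁆) (z0 : z ≠ 0) (b0 : b ≠ 0)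
    (h4 : ⁅a + b, ⁅a + b, ⁅a + b, ⁅a + b, y⁆⁆⁆⁆ = 0) : False := by
  have ba : ⁅b, a⁆ = -z := by rw [← lie_skew, hz]
  have sk : ∀ {x x' r : L}, ⁅x, x'⁆ = r → ⁅x', x⁆ = -r := fun {x x' r} h => by rw [← lie_skew, h]
  obtain ⟨k, hk⟩ : ∃ k, ⁅z, u⁆ = k := ⟨_, rfl⟩
  rw [hk] at w5 w6
  have k1 : h = k + h' := by
    have := leibniz_lie a b u
    rw [hw, hh, hz, hk, hv, hh'] at this
    exact this
  have p0 : p ≠ 0 := by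
    rintro rfl
    have := leibniz_lie b a w
    rw [hh, ba, neg_lie, bw, lie_zero, add_zero, sk w1, zero_smul, neg_zero] at this
    exact zw (by rw [← neg_eq_zero, ← this])
  have uz : ∀ X : L, ⁅u, ⁅z, X⁆⁆ = -⁅k, X⁆ + ⁅z, ⁅u, X⁆⁆ := by
    intro X; rw [leibniz_lie u z X, sk hk, neg_lie]
  have kz : ∀ X : L, ⁅k, ⁅z, X⁆⁆ = g • ⁅z, X⁆ + ⁅z, ⁅k, X⁆⁆ := by
    intro X; rw [leibniz_lie k z X, w5, smul_lie]
  have kzw : ⁅k, ⁅z, w⁆⁆ = (g + c) • ⁅z, w⁆ := by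
    rw [kz, w6, lie_smul, add_smul]
  have kzzw : ⁅k, ⁅z, ⁅z, w⁆⁆⁆ = (2 * g + c) • ⁅z, ⁅z, w⁆⁆ := by
    rw [kz, kzw, lie_smul]; module
  have gc : g + c = 0 := by
    have h := uz ⁅z, ⁅z, w⁆⁆
    rw [zzz, lie_zero, uz, uz, uw, lie_zero, add_zero, w6, kzw, kzzw, lie_add, lie_neg, lie_neg,
      lie_neg, lie_smul, lie_smul, lie_smul] at h
    have h' : (-3 * (g + c)) • ⁅z, ⁅z, w⁆⁆ = 0 := by rw [h]; module
    have := (smul_eq_zero.1 h').resolve_right zz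
    linear_combination (-1 / 3) * this
  have kb : ⁅k, b⁆ = 0 := by rw [hb, lie_smul, kzw, gc, zero_smul, smul_zero]
  have pp : p = p' := by
    have : p • b = p' • b := by rw [← w1, ← w2, k1, add_lie, kb, zero_add]
    exact smul_left_injective ℂ b0 this
  have n1 : ⁅a + b, y⁆ = u := by rw [add_lie, ay, hu, zero_add]
  have n2 : ⁅a + b, u⁆ = v + w := by rw [add_lie, hv, hw]
  have n3 : ⁅a + b, v + w⁆ = h + h' := by
    rw [add_lie, lie_add, lie_add, av, bw, hh, hh']; abel
  have n4 : ⁅a + b, h + h'⁆ = (-(q + q')) • a + (-(2 * p)) • b := by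
    rw [add_lie, lie_add, lie_add, sk w1, sk w2, sk w3, sk w4, ← pp]; module
  rw [n1, n2, n3, n4] at h4
  have h5 : ⁅a, (-(q + q')) • a + (-(2 * p)) • b⁆ = 0 := by rw [h4, lie_zero]
  rw [lie_add, lie_smul, lie_smul, lie_self, smul_zero, zero_add, hz] at h5
  have := (smul_eq_zero.1 h5).resolve_right z0
  exact p0 (by linear_combination this / (-2))

variable {D : LieRootData V L} {Ψ : Set V}

lemma big (hirr : D.IsIrreducible) (hG : D.NotG2) {β v : V} (hβ : β ∈ D.roots)
    (h : 2 * ⟪β, β⟫ < ⟪v, v⟫) : v ∉ D.roots ∧ v ≠ 0 := by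
  have h0 := self_pos _ hβ
  constructor
  · intro hv
    obtain ⟨θ, hθ⟩ := exists_top _ hirr
    have hT := self_pos _ hθ.root
    rcases lengths hirr hG hθ hβ with h1 | h1 <;> rcases lengths hirr hG hθ hv with h2 | h2 <;>
      linarith
  · rintro rfl
    rw [inner_zero_left] at h
    linarith

lemma br0 (hirr : D.IsIrreducible) (hG : D.NotG2) {r α β γ : V} (hr : r ∈ D.roots)
    (hα : α ∈ D.roots) (hβ : β ∈ D.roots) (e : α + β = γ) (h : 2 * ⟪r, r⟫ < ⟪γ, γ⟫) {x y : L}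
    (hx : x ∈ D.rs α) (hy : y ∈ D.rs β) : ⁅x, y⁆ = 0 := by
  subst e
  have := big hirr hG hr h
  exact D.bracket_eq_zero α hα β hβ this.1 this.2 x hx y hy

lemma brm {α β γ : V} (hα : α ∈ D.roots) (hβ : β ∈ D.roots) (hγ : γ ∈ D.roots) (e : α + β = γ)
    {x y : L} (hx : x ∈ D.rs α) (hy : y ∈ D.rs β) : ⁅x, y⁆ ∈ D.rs γ := by
  subst e; exact D.bracket_mem α hα β hβ hγ x hx y hy

lemma brn {α β γ : V} (hα : α ∈ D.roots) (hβ : β ∈ D.roots) (hγ : γ ∈ D.roots) (e : α + β = γ)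
    {x y : L} (hx : x ∈ D.rs α) (hy : y ∈ D.rs β) (hx0 : x ≠ 0) (hy0 : y ≠ 0) : ⁅x, y⁆ ≠ 0 := by
  subst e; exact D.bracket_ne_zero α hα β hβ hγ x hx hx0 y hy hy0

lemma brc {α β : V} (hα : α ∈ D.roots) (e : β = -α)
    {x y : L} (hx : x ∈ D.rs α) (hy : y ∈ D.rs β) : ⁅x, y⁆ ∈ D.cartan := by
  subst e; exact D.bracket_cartan_mem α hα x hx y hy

lemma A2_case (hirr : D.IsIrreducible) (hG : D.NotG2) {α β : V} (hα : α ∈ D.roots)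
    (hβ : β ∈ D.roots) (hs : α + β ∈ D.roots) (hl : ⟪α, α⟫ = ⟪β, β⟫)
    (hn : 2 * ⟪α, β⟫ = -⟪β, β⟫) (H : ∀ a ∈ D.rs α, ∀ b ∈ D.rs β,
      (LieAlgebra.ad ℂ L (a + b)) ^ 4 = 0) : False := by
  have hc := real_inner_comm α β
  have h0 := self_pos _ hα
  obtain ⟨a, ha, a0, -⟩ := rs_line D hα
  obtain ⟨b, hb, b0, -⟩ := rs_line D hβ
  obtain ⟨y, hy, y0, -⟩ := rs_line D (neg_mem _ hs)
  have nα := neg_mem _ hα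
  have nβ := neg_mem _ hβ
  have nS := neg_mem _ hs
  have hz := brm hα hβ hs rfl ha hb
  have z0 := brn hα hβ hs rfl ha hb a0 b0
  have hy0 := brm hα nS nβ (by abel) ha hy
  have y00 := brn hα nS nβ (by abel) ha hy a0 y0
  have hy1 := brm hβ nS nα (by abel) hb hy
  have e0 := br0 hirr hG hα hα nβ (γ := α - β) (by abel)
    (by simp only [inner_sub_left, inner_sub_right]; linarith) ha hy0
  have e1 := br0 hirr hG hα hβ nα (γ := β - α) (by abel)
    (by simp only [inner_sub_left, inner_sub_right]; linarith) hb hy1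
  have az := br0 hirr hG hα hα hs (γ := α + (α + β)) (by abel)
    (by simp only [inner_add_left, inner_add_right]; linarith) ha hz
  have bz := br0 hirr hG hα hβ hs (γ := β + (α + β)) (by abel)
    (by simp only [inner_add_left, inner_add_right]; linarith) hb hz
  have h1 := brc hβ rfl hb hy0
  have h2 := brc hα rfl ha hy1
  obtain ⟨t, w1⟩ := D.weight_vec α hα _ h1 a ha
  obtain ⟨t', w2⟩ := D.weight_vec β hβ _ h1 b hb
  obtain ⟨s, w3⟩ := D.weight_vec α hα _ h2 a ha
  obtain ⟨s', w4⟩ := D.weight_vec β hβ _ h2 b hb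
  have ne := brn nβ hs hα (by abel) hy0 hz y00 z0
  refine A2_abs rfl rfl rfl e0 e1 rfl rfl az bz w1 w2 w3 w4 a0 z0 ne ?_
  rw [← ad4, H a ha b hb]; rfl

lemma B2_case (hirr : D.IsIrreducible) (hG : D.NotG2) {α β : V} (hα : α ∈ D.roots)
    (hβ : β ∈ D.roots) (hs : α + β ∈ D.roots) (hl : ⟪α, α⟫ = 2 * ⟪β, β⟫)
    (hn : ⟪α, β⟫ = -⟪β, β⟫) (H : ∀ a ∈ D.rs α, ∀ b ∈ D.rs β,
      (LieAlgebra.ad ℂ L (a + b)) ^ 4 = 0) : False := by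
  have hc := real_inner_comm α β
  have h0 := self_pos _ hβ
  have hq : α + β + β ∈ D.roots := by
    have h1 := refl_mem' _ hα hβ
    have h2 : cpair α β = -2 := by
      unfold cpair; rw [hn]; field_simp
    rw [h2] at h1
    convert h1 using 1
    module
  have nα := neg_mem _ hα
  have nβ := neg_mem _ hβ
  have nS := neg_mem _ hs
  have nQ := neg_mem _ hq
  obtain ⟨a, ha, a0, -⟩ := rs_line D hα
  obtain ⟨b, hb, b0, -⟩ := rs_line D hβ
  obtain ⟨y, hy, y0, -⟩ := rs_line D nQ
  have hz := brm hα hβ hs rfl ha hb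
  have z0 := brn hα hβ hs rfl ha hb a0 b0
  have ay := br0 hirr hG hβ hα nQ (γ := -β - β) (by abel)
    (by simp only [inner_sub_left, inner_sub_right, inner_neg_left, inner_neg_right]; linarith) ha hy
  have hu := brm hβ nQ nS (by abel) hb hy
  have u0 := brn hβ nQ nS (by abel) hb hy b0 y0
  have hv := brm hα nS nβ (by abel) ha hu
  have hw := brm hβ nS nα (by abel) hb hu
  have w0 := brn hβ nS nα (by abel) hb hu b0 u0
  have av := br0 hirr hG hβ hα nβ (γ := α - β) (by abel)
    (by simp only [inner_sub_left, inner_sub_right]; linarith) ha hv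
  have bw := br0 hirr hG hβ hβ nα (γ := β - α) (by abel)
    (by simp only [inner_sub_left, inner_sub_right]; linarith) hb hw
  have hh := brc hα rfl ha hw
  have hh' := brc hβ rfl hb hv
  have hk := brc hs rfl hz hu
  obtain ⟨p, w1⟩ := D.weight_vec β hβ _ hh b hb
  obtain ⟨p', w2⟩ := D.weight_vec β hβ _ hh' b hb
  obtain ⟨q, w3⟩ := D.weight_vec α hα _ hh a ha
  obtain ⟨q', w4⟩ := D.weight_vec α hα _ hh' a ha
  obtain ⟨g, w5⟩ := D.weight_vec _ hs _ hk _ hz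
  obtain ⟨c, w6⟩ := D.weight_vec _ nα _ hk _ hw
  have uw := br0 hirr hG hβ nS nα (γ := -α - β - α) (by abel)
    (by simp only [inner_sub_left, inner_sub_right, inner_neg_left, inner_neg_right]; linarith) hu hw
  have hzw := brm hs nα hβ (by abel) hz hw
  have zw := brn hs nα hβ (by abel) hz hw z0 w0
  have hzzw := brm hs hβ hq (by abel) hz hzw
  have zzw := brn hs hβ hq (by abel) hz hzw z0 zw
  have zzz := br0 hirr hG hβ hs hq (γ := α + β + (α + β + β)) (by abel)
    (by simp only [inner_add_left, inner_add_right]; linarith) hz hzzw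
  obtain ⟨r, hr⟩ := rs_line' D hβ hzw zw hb
  refine B2_abs rfl ay rfl rfl rfl av bw rfl rfl w1 w2 w3 w4 w5 w6 uw zzz zzw zw hr z0 b0 ?_
  rw [← ad4, H a ha b hb]; rfl

theorem nonneg_of (hirr : D.IsIrreducible) (hG : D.NotG2) (hΨ : D.CombIdeal Ψ)
    (hsph : IsSphericalSubspace (D.aSubspace Ψ)) {α β : V} (hα : α ∈ Ψ) (hβ : β ∈ Ψ) :
    0 ≤ ⟪α, β⟫ := by
  by_contra hneg
  push Not at hneg
  have rα := D.pos_subset (hΨ.1 hα)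
  have rβ := D.pos_subset (hΨ.1 hβ)
  have hne := pos_add_ne _ (hΨ.1 hα) (hΨ.1 hβ)
  have hs := add_mem _ rα rβ hneg hne
  have sub : ∀ γ ∈ Ψ, D.rs γ ≤ D.aSubspace Ψ := fun γ hγ =>
    le_iSup₂_of_le (f := fun γ (_ : γ ∈ Ψ) => D.rs γ) γ hγ le_rfl
  have H : ∀ a ∈ D.rs α, ∀ b ∈ D.rs β, (LieAlgebra.ad ℂ L (a + b)) ^ 4 = 0 := fun a ha b hb =>
    hsph _ (Submodule.add_mem _ (sub α hα ha) (sub β hβ hb))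
  have hp := pos_pair hG rα (neg_mem _ rβ) (by rw [inner_neg_right]; linarith)
    (fun h => hne (by rw [h]; abel))
  simp only [inner_neg_right, inner_neg_left, neg_neg] at hp
  rcases hp with ⟨h1, h2⟩ | ⟨h1, h2⟩ | ⟨h1, h2⟩
  · exact A2_case hirr hG rα rβ hs h1 (by linarith) H
  · exact B2_case hirr hG rα rβ hs h1 (by linarith) H
  · refine B2_case hirr hG rβ rα (by rw [add_comm]; exact hs) h1
      (by rw [real_inner_comm]; linarith) (fun b hb a ha => ?_)
    rw [add_comm]; exact H a ha b hb

lemma cpair_nonneg_iff {α β : V} (hβ : β ∈ D.roots) : 0 ≤ cpair α β ↔ 0 ≤ ⟪α, β⟫ := by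
  have h := cpair_mul D.toRootSystemData (α := α) hβ
  have h0 := self_pos _ hβ
  constructor
  · intro h1
    have := mul_nonneg h1 h0.le
    linarith
  · intro h1
    unfold cpair; positivity

end Fwd

end SphAux

/-- If `Φ` is irreducible and not of type `G₂` and `Ψ ⊆ Φ⁺` is a
combinatorial ideal, then `𝔞_Ψ = ⊕_{α ∈ Ψ} 𝔤_α` is a spherical subspace of `𝔫` if
and only if `⟨α, β⟩ ≥ 0` for all `α, β ∈ Ψ`. -/
theorem combIdeal_spherical_iff_pairing_nonneg
    {V : Type*} [NormedAddCommGroup V] [InnerProductSpace ℝ V]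
    {L : Type*} [LieRing L] [LieAlgebra ℂ L]
    (D : LieRootData V L)
    (hirr : D.toRootSystemData.IsIrreducible)
    (hG2 : D.toRootSystemData.NotG2)
    (Ψ : Set V) (hΨ : D.toRootSystemData.CombIdeal Ψ) :
    IsSphericalSubspace (D.aSubspace Ψ) ↔ ∀ α ∈ Ψ, ∀ β ∈ Ψ, 0 ≤ cpair α β := by
  constructor
  · intro h α hα β hβ
    exact (SphAux.cpair_nonneg_iff (D := D) (D.pos_subset (hΨ.1 hβ))).2
      (SphAux.nonneg_of hirr hG2 hΨ h hα hβ)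
  · intro h
    exact SphAux.spherical_of hirr hG2 hΨ (fun a ha b hb =>
      (SphAux.cpair_nonneg_iff (D := D) (D.pos_subset (hΨ.1 hb))).1 (h a ha b hb))
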